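/- arXiv:2204.07784 — 4 statements merged into one kernel-verified Lean document; each statement's English description precedes it below -/
import Mathlib

section
/- Let m ≥ 2, F(x) = x^m + A x^{m-1} + B ∈ ℤ[x], and D = m^m B - (-1)^m (m-1)^{m-1} A^m. Suppose B is squarefree with |B| ≥ 2, D is squarefree, and F(x) is irreducible over ℚ. Then F(x) is monogenic, i.e., if θ is a root of F and K = ℚ(θ), then the ring of integers of K equals ℤ[θ]. -/
open Polynomial

section LocalUniformizer

variable {R : Type*} [CommRing R] [IsDomain R]

/-- A nonzero prime of a Noetherian domain whose extension to the localization is generated by a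
single element localizes to a discrete valuation ring. -/
theorem isDiscreteValuationRing_localization_of_exists_mul_mem_span [IsNoetherianRing R]
    {P : Ideal R} [P.IsPrime] (hP : P ≠ ⊥) {ϖ : R} (hϖ : ϖ ∈ P)
    (h : ∀ x ∈ P, ∃ s ∉ P, ϖ ∣ s * x) :
    IsDiscreteValuationRing (Localization.AtPrime P) := by
  have := IsLocalization.isNoetherianRing P.primeCompl (Localization.AtPrime P) ‹_›
  have := IsLocalization.isDomain_localization P.primeCompl_le_nonZeroDivisors
  have hmap := Localization.AtPrime.map_eq_maximalIdeal (I := P)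
  have hinj := IsLocalization.injective (Localization.AtPrime P) P.primeCompl_le_nonZeroDivisors
  have hfield : ¬ IsField (Localization.AtPrime P) := by
    rw [IsLocalRing.isField_iff_maximalIdeal_eq, ← hmap,
      Ideal.map_eq_bot_iff_of_injective hinj]
    exact hP
  suffices h : (IsLocalRing.maximalIdeal (Localization.AtPrime P)).IsPrincipal from
    ((IsDiscreteValuationRing.TFAE _ hfield).out 0 4).mpr h
  refine ⟨algebraMap R (Localization.AtPrime P) ϖ, ?_⟩
  rw [← hmap, Ideal.submodule_span_eq]
  refine le_antisymm (Ideal.map_le_iff_le_comap.mpr fun x hx ↦ ?_) ?_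
  · obtain ⟨s, hs, hdvd⟩ := h x hx
    have hu : IsUnit (algebraMap R (Localization.AtPrime P) s) :=
      IsLocalization.map_units _ (⟨s, hs⟩ : P.primeCompl)
    rw [Ideal.mem_comap, Ideal.mem_span_singleton, ← hu.dvd_mul_left, ← map_mul]
    exact map_dvd _ hdvd
  · rw [Ideal.span_singleton_le_iff_mem]
    exact Ideal.mem_map_of_mem _ hϖ

end LocalUniformizer

section Monogenic

variable {R : Type*} [CommRing R]

theorem intCast_mem_iff_dvd_of_prime {P : Ideal R} (hP : P ≠ ⊤) {p : ℤ} (hp : Prime p)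
    (hpP : (p : R) ∈ P) {a : ℤ} : (a : R) ∈ P ↔ p ∣ a := by
  refine ⟨fun ha ↦ ?_, fun ⟨b, hb⟩ ↦ ?_⟩
  · by_contra hdvd
    obtain ⟨u, v, huv⟩ := hp.irreducible.coprime_iff_not_dvd.mpr hdvd
    refine hP ((Ideal.eq_top_iff_one _).mpr ?_)
    have h1 : (u : R) * p + v * a = 1 := by exact_mod_cast congrArg (Int.cast (R := R)) huv
    exact h1 ▸ P.add_mem (P.mul_mem_left _ hpP) (P.mul_mem_left _ ha)
  · rw [hb, Int.cast_mul]
    exact P.mul_mem_right _ hpP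

/-- If a prime `P` over `p` contains `ϖ`, contains `θ - t` as an element of `(p, ϖ)`, and
`s * p ∈ (ϖ)` for some `s ∉ P`, then `ϖ` generates `P` locally. -/
theorem exists_mul_mem_span_of_linear {P : Ideal R} [hP : P.IsPrime] {θ : R}
    (hθ : ∀ x : R, ∃ g : ℤ[X], aeval θ g = x) {p : ℤ} (hp : Prime p) (hpP : (p : R) ∈ P)
    {ϖ : R} (hϖ : ϖ ∈ P) {t : ℤ} {v w : R} (ht : θ - t = p * v + ϖ * w)
    {s : R} (hs : s ∉ P) (hsp : ϖ ∣ s * p) :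
    ∀ x ∈ P, ∃ s ∉ P, ϖ ∣ s * x := by
  intro x hx
  refine ⟨s, hs, ?_⟩
  obtain ⟨g, rfl⟩ := hθ x
  obtain ⟨q, hq⟩ : θ - t ∣ aeval θ g - ((g.eval t : ℤ) : R) := by
    have := sub_dvd_eval_sub θ (t : R) (g.map (Int.castRingHom R))
    simpa [aeval_def, eval_map, eval₂_at_intCast] using this
  have hmem : ((g.eval t : ℤ) : R) ∈ P := by
    have h1 : θ - t ∈ P := ht ▸ P.add_mem (P.mul_mem_right _ hpP) (P.mul_mem_right _ hϖ)
    have h2 : ((g.eval t : ℤ) : R) = aeval θ g - (θ - t) * q := by rw [← hq]; ring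
    exact h2 ▸ P.sub_mem hx (P.mul_mem_right _ h1)
  obtain ⟨c, hc⟩ := (intCast_mem_iff_dvd_of_prime hP.ne_top hp hpP).mp hmem
  obtain ⟨r, hr⟩ := hsp
  refine ⟨r * c + r * v * q + s * w * q, ?_⟩
  rw [hc, ht] at hq
  push_cast at hq
  linear_combination s * hq + (c + v * q) * hr

/-- If `F(θ) = 0` and `F'(θ)` avoids an ideal `P` over `p`, then `p` generates `P` locally. -/
theorem exists_mul_mem_span_of_aeval_derivative_notMem {P : Ideal R} {θ : R}
    (hθ : ∀ x : R, ∃ g : ℤ[X], aeval θ g = x) {p : ℕ} [Fact p.Prime] (hpP : (p : R) ∈ P)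
    {F : ℤ[X]} (hF : aeval θ F = 0) (hF' : aeval θ (derivative F) ∉ P) :
    ∀ x ∈ P, ∃ s ∉ P, (p : R) ∣ s * x := by
  let φ : ℤ[X] →+* (ZMod p)[X] := mapRingHom (Int.castRingHom (ZMod p))
  have hφ : Function.Surjective φ := map_surjective _ (ZMod.ringHom_surjective _)
  have hker : ∀ f g : ℤ[X], φ f = φ g → ∃ w, f = g + C (p : ℤ) * w := by
    intro f g hfg
    have : C (p : ℤ) ∣ f - g := by
      rw [C_dvd_iff_dvd_coeff]
      intro i
      have := congrArg (coeff · i) hfg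
      simp only [φ, coe_mapRingHom, coeff_map, eq_intCast] at this
      rw [coeff_sub]
      exact (ZMod.intCast_eq_intCast_iff_dvd_sub _ _ p).mp this.symm
    obtain ⟨w, hw⟩ := this
    exact ⟨w, by rw [← hw]; ring⟩
  let J : Ideal ℤ[X] := P.comap (aeval θ : ℤ[X] →ₐ[ℤ] R)
  obtain ⟨γ, hγ⟩ := (IsPrincipalIdealRing.principal (J.map φ)).principal
  rw [Ideal.submodule_span_eq] at hγ
  have hγJ : γ ∈ J.map φ := hγ ▸ Ideal.mem_span_singleton_self γ
  obtain ⟨g, hgJ, rfl⟩ := (Ideal.mem_map_iff_of_surjective φ hφ).mp hγJ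
  have hgP : aeval θ g ∈ P := hgJ
  have hfactor : ∀ k ∈ J, ∃ h w, k = g * h + C (p : ℤ) * w := by
    intro k hk
    have : φ k ∈ J.map φ := Ideal.mem_map_of_mem _ hk
    rw [hγ, Ideal.mem_span_singleton] at this
    obtain ⟨η, hη⟩ := this
    obtain ⟨h, rfl⟩ := hφ η
    obtain ⟨w, hw⟩ := hker k (g * h) (by rw [hη, map_mul])
    exact ⟨h, w, hw⟩
  obtain ⟨h, w, hFgh⟩ := hfactor F (by simp [J, hF])
  have hh : aeval θ h ∉ P := by
    intro hh
    apply hF'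
    rw [hFgh]
    simp only [derivative_mul, derivative_natCast, map_add, map_mul, zero_mul,
      zero_add, map_natCast]
    exact P.add_mem (P.add_mem (P.mul_mem_left _ hh) (P.mul_mem_right _ hgP))
      (P.mul_mem_right _ hpP)
  intro x hx
  refine ⟨_, hh, ?_⟩
  obtain ⟨k, rfl⟩ := hθ x
  obtain ⟨q, v, rfl⟩ := hfactor k hx
  have h0 : aeval θ g * aeval θ h + p * aeval θ w = 0 := by
    rw [← hF, hFgh]; simp
  refine ⟨aeval θ h * aeval θ v - aeval θ w * aeval θ q, ?_⟩
  simp only [map_add, map_mul, map_natCast]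
  linear_combination aeval θ q * h0

end Monogenic

section Trinomial

variable {R : Type*} [CommRing R]

/-- A root `θ` of `x ^ (n + 2) + A x ^ (n + 1) + B` satisfies
`(n + 2) θ + (n + 1) A ∣ D`, where `D` is the discriminant factor of the trinomial. -/
theorem linear_dvd_trinomial_discr {n : ℕ} {A B θ : R}
    (h : θ ^ (n + 2) + A * θ ^ (n + 1) + B = 0) :
    (n + 2) * θ + (n + 1) * A ∣
      (n + 2) ^ (n + 2) * B - (-1) ^ (n + 2) * (n + 1) ^ (n + 1) * A ^ (n + 2) := by
  obtain ⟨q, hq⟩ := sub_dvd_pow_sub_pow ((n + 2) * θ) (-((n + 1) * A)) (n + 1)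
  refine ⟨-(((n : R) + 2) ^ (n + 1) * θ ^ (n + 1) + q * A), ?_⟩
  have e : (-((n + 1) * A)) ^ (n + 1) = (-1) ^ (n + 1) * ((n + 1) ^ (n + 1) * A ^ (n + 1)) := by
    rw [neg_pow, mul_pow]
  rw [e, mul_pow] at hq
  linear_combination ((n : R) + 2) ^ (n + 2) * h - A * hq

variable [IsDomain R]

theorem isDedekindDomainDvr_of_trinomial {n : ℕ} {A B : ℤ} {θ : R}
    (hθ : ∀ x : R, ∃ g : ℤ[X], aeval θ g = x) (hB : Squarefree B)
    (hD : Squarefree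
      ((n + 2) ^ (n + 2) * B - (-1) ^ (n + 2) * (n + 1) ^ (n + 1) * A ^ (n + 2)))
    (hroot : θ ^ (n + 2) + (A : R) * θ ^ (n + 1) + (B : R) = 0) :
    IsDedekindDomainDvr R := by
  have hnoeth : IsNoetherianRing R :=
    isNoetherianRing_of_surjective ℤ[X] R (aeval θ : ℤ[X] →ₐ[ℤ] R).toRingHom hθ
  let F : ℤ[X] := X ^ (n + 2) + C A * X ^ (n + 1) + C B
  have hFroot : aeval θ F = 0 := by simpa [F] using hroot
  have hmonic : F.Monic := by
    have : F = X ^ (n + 2) + (C A * X ^ (n + 1) + C B) := by simp only [F]; ring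
    rw [this]
    refine monic_X_pow_add (lt_of_le_of_lt (b := ((n + 1 : ℕ) : WithBot ℕ)) ?_ ?_)
    · compute_degree
      exact max_le (by norm_cast) (by exact_mod_cast Nat.zero_le _)
    · exact_mod_cast Nat.lt_succ_self (n + 1)
  have hintegral : ∀ x : R, IsIntegral ℤ x := by
    intro x
    obtain ⟨g, rfl⟩ := hθ x
    exact (IsIntegral.of_mem_of_fg _ (IsIntegral.fg_adjoin_singleton ⟨F, hmonic, hFroot⟩) _
      (aeval_mem_adjoin_singleton ℤ θ))
  refine { hnoeth with is_dvr_at_nonzero_prime := fun P hPbot hP ↦ ?_ }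
  obtain ⟨p, hp, hpP⟩ : ∃ p : ℕ, p.Prime ∧ (p : R) ∈ P := by
    obtain ⟨y, hyP, hy0⟩ := Submodule.exists_mem_ne_zero_of_ne_bot hPbot
    have hcomap := Ideal.comap_ne_bot_of_integral_mem hy0 hyP (hintegral y)
    have hprime : (P.comap (algebraMap ℤ R)).IsPrime := inferInstance
    obtain ⟨a, ha⟩ := (IsPrincipalIdealRing.principal (P.comap (algebraMap ℤ R))).principal
    rw [Ideal.submodule_span_eq] at ha
    rw [ha] at hcomap hprime
    have ha0 : a ≠ 0 := fun h ↦ hcomap (by simp [h])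
    have hap := (Ideal.span_singleton_prime ha0).mp hprime
    refine ⟨a.natAbs, Int.prime_iff_natAbs_prime.mp hap, ?_⟩
    have haP : (a : R) ∈ P := by
      have : a ∈ P.comap (algebraMap ℤ R) := ha ▸ Ideal.mem_span_singleton_self a
      simpa using this
    rcases Int.natAbs_eq a with h | h
    · rwa [h, Int.cast_natCast] at haP
    · rwa [h, Int.cast_neg, Int.cast_natCast, neg_mem_iff] at haP
  have hpZ : Prime (p : ℤ) := Nat.prime_iff_prime_int.mp hp
  have hpP' : ((p : ℤ) : R) ∈ P := by exact_mod_cast hpP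
  have hmem {a : ℤ} : (a : R) ∈ P ↔ (p : ℤ) ∣ a :=
    intCast_mem_iff_dvd_of_prime hP.ne_top hpZ hpP'
  have hcofactor {a b : ℤ} (ha : Squarefree a) (hab : a = p * b) : (b : R) ∉ P := by
    rw [hmem]
    rintro ⟨c, rfl⟩
    exact hpZ.not_isUnit (ha p ⟨c, by rw [hab]; ring⟩)
  by_cases hθP : θ ∈ P
  · have hBP : (B : R) ∈ P := by
      have : (B : R) = -(θ ^ (n + 1) + A * θ ^ n) * θ := by linear_combination hroot
      exact this ▸ P.mul_mem_left _ hθP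
    obtain ⟨b, hb⟩ := hmem.mp hBP
    refine isDiscreteValuationRing_localization_of_exists_mul_mem_span hPbot hθP
      (exists_mul_mem_span_of_linear hθ hpZ hpP' hθP (t := 0) (v := 0) (w := 1) (by simp)
        (hcofactor hB hb) ⟨-(θ ^ (n + 1) + A * θ ^ n), ?_⟩)
    have hb' : (B : R) = ((p : ℤ) : R) * b := by rw [hb]; push_cast; rfl
    linear_combination hroot - hb'
  by_cases hϖ : ((n : R) + 2) * θ + (n + 1) * A ∈ P
  · have hdvd := linear_dvd_trinomial_discr hroot
    have hDP := P.mem_of_dvd hdvd hϖ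
    have hcast : (((n + 2) ^ (n + 2) * B - (-1) ^ (n + 2) * (n + 1) ^ (n + 1) * A ^ (n + 2) : ℤ)
        : R) = (n + 2) ^ (n + 2) * B - (-1) ^ (n + 2) * (n + 1) ^ (n + 1) * A ^ (n + 2) := by
      push_cast; ring
    rw [← hcast] at hDP hdvd
    obtain ⟨d, hd⟩ := hmem.mp hDP
    have hpn : ¬ (p : ℤ) ∣ n + 2 := by
      intro hpn
      have hnP : ((n : R) + 2) ∈ P := by
        have := hmem.mpr hpn
        push_cast at this
        exact this
      have hAP : (A : R) ∈ P := by
        have : (A : R) = (n + 2) * (θ + A) - ((n + 2) * θ + (n + 1) * A) := by ring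
        rw [this]
        exact P.sub_mem (P.mul_mem_right _ hnP) hϖ
      refine hpZ.not_isUnit (hD p ?_)
      have hpow {a : ℤ} (ha : (p : ℤ) ∣ a) : (p : ℤ) * p ∣ a ^ (n + 2) :=
        (mul_dvd_mul ha ha).trans ⟨a ^ n, by ring⟩
      exact dvd_sub ((hpow hpn).mul_right _) ((hpow (hmem.mp hAP)).mul_left _)
    obtain ⟨u, v, huv⟩ := hpZ.irreducible.coprime_iff_not_dvd.mpr hpn
    have huv' : (u : R) * p + v * (n + 2) = 1 := by
      exact_mod_cast congrArg (Int.cast (R := R)) huv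
    refine isDiscreteValuationRing_localization_of_exists_mul_mem_span hPbot hϖ
      (exists_mul_mem_span_of_linear hθ hpZ hpP' hϖ (t := -(v * (n + 1) * A)) (v := u * θ) (w := v)
        ?_ (hcofactor hD hd) ?_)
    · push_cast
      linear_combination (-θ) * huv'
    · rw [hd] at hdvd
      push_cast at hdvd ⊢
      rwa [mul_comm (d : R)]
  · have := Fact.mk hp
    refine isDiscreteValuationRing_localization_of_exists_mul_mem_span hPbot hpP
      (exists_mul_mem_span_of_aeval_derivative_notMem hθ hpP hFroot ?_)
    have : aeval θ (derivative F) = θ ^ n * ((n + 2) * θ + (n + 1) * A) := by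
      simp [F]
      ring
    rw [this]
    exact fun h ↦ (hP.mem_or_mem h).elim (fun h ↦ hθP (hP.mem_of_pow_mem _ h)) hϖ

end Trinomial

/-- If `θ` generates the number field `K`, then `ℤ[θ]` is the full ring of integers as soon as it
is integrally closed. -/
theorem adjoin_eq_top_of_isIntegrallyClosed {K : Type*} [Field K] [NumberField K]
    {θ : NumberField.RingOfIntegers K} (hgen : Algebra.adjoin ℚ {(θ : K)} = ⊤)
    [IsIntegrallyClosed (Algebra.adjoin ℤ {θ})] : Algebra.adjoin ℤ {θ} = ⊤ := by
  have hinj : Function.Injective (algebraMap (Algebra.adjoin ℤ {θ}) K) :=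
    NumberField.RingOfIntegers.coe_injective.comp Subtype.val_injective
  have := (faithfulSMul_iff_algebraMap_injective (Algebra.adjoin ℤ {θ}) K).mpr hinj
  have hfrac : IsFractionRing (Algebra.adjoin ℤ {θ}) K := by
    refine IsFractionRing.of_field _ _ fun z ↦ ?_
    have hz : z ∈ Algebra.adjoin ℚ {(θ : K)} := hgen ▸ Algebra.mem_top
    rw [Algebra.adjoin_singleton_eq_range_aeval] at hz
    obtain ⟨g, rfl⟩ := hz
    obtain ⟨b, hbmem, hb⟩ := IsLocalization.integerNormalization_spec (nonZeroDivisors ℤ) g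
    have hb0 : (b : K) ≠ 0 := by exact_mod_cast nonZeroDivisors.ne_zero hbmem
    refine ⟨⟨aeval θ (IsLocalization.integerNormalization (nonZeroDivisors ℤ) g),
      aeval_mem_adjoin_singleton ℤ θ⟩, (b : Algebra.adjoin ℤ {θ}), ?_⟩
    rw [map_intCast, eq_div_iff hb0]
    have h := congrArg (aeval (θ : K)) hb
    rw [aeval_map_algebraMap, map_zsmul, zsmul_eq_mul] at h
    rw [AlgHom.toRingHom_eq_coe, RingHom.coe_coe, mul_comm, ← h]
    exact aeval_algebraMap_apply K θ _
  refine eq_top_iff.mpr fun x _ ↦ ?_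
  have hx : IsIntegral (Algebra.adjoin ℤ {θ}) (x : K) :=
    (NumberField.RingOfIntegers.isIntegral_coe x).tower_top
  obtain ⟨y, hy⟩ := IsIntegrallyClosed.algebraMap_eq_of_integral hx
  have : (y : NumberField.RingOfIntegers K) = x := NumberField.RingOfIntegers.coe_injective hy
  exact this ▸ y.2

theorem stmt_11 (m : ℕ) (hm : 2 ≤ m) (A B : ℤ)
    (F : Polynomial ℤ) (hF : F = X ^ m + C A * X ^ (m - 1) + C B)
    (hB : Squarefree B) (hB2 : 2 ≤ |B|)
    (hD : Squarefree ((m : ℤ) ^ m * B - (-1) ^ m * ((m : ℤ) - 1) ^ (m - 1) * A ^ m))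
    (hirr : Irreducible (F.map (Int.castRingHom ℚ)))
    (K : Type*) [Field K] [NumberField K] (θ : NumberField.RingOfIntegers K)
    (hroot : Polynomial.aeval (θ : K) F = 0)
    (hgen : Algebra.adjoin ℚ {(θ : K)} = ⊤) :
    Algebra.adjoin ℤ {θ} = ⊤ := by
  obtain ⟨n, rfl⟩ := Nat.exists_eq_add_of_le' hm
  have hD' : Squarefree
      (((n : ℤ) + 2) ^ (n + 2) * B - (-1) ^ (n + 2) * (n + 1) ^ (n + 1) * A ^ (n + 2)) := by
    have h : ((n + 2 : ℕ) : ℤ) - 1 = n + 1 := by push_cast; ring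
    rw [h] at hD
    exact_mod_cast hD
  let α : Algebra.adjoin ℤ {θ} := ⟨θ, Algebra.self_mem_adjoin_singleton ℤ θ⟩
  have hα : ∀ x : Algebra.adjoin ℤ {θ}, ∃ g : ℤ[X], aeval α g = x := by
    rintro ⟨x, hx⟩
    have hx' := hx
    rw [Algebra.adjoin_singleton_eq_range_aeval] at hx'
    obtain ⟨g, rfl⟩ := hx'
    exact ⟨g, Subtype.ext (aeval_algebraMap_apply (NumberField.RingOfIntegers K) α g).symm⟩
  have hαroot : α ^ (n + 2) + (A : Algebra.adjoin ℤ {θ}) * α ^ (n + 1) + B = 0 := by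
    apply Subtype.ext
    apply NumberField.RingOfIntegers.coe_injective
    simpa [hF, α] using hroot
  have := isDedekindDomainDvr_of_trinomial hα hB hD' hαroot
  exact adjoin_eq_top_of_isIntegrallyClosed hgen
end

section
/- Let p ≥ 3 be prime and let F(x) = x^2 + A x + B with A = 4pu + p^2 + 2 and B = 2pt + 1 for integers u, t such that B, B - 1, and D = 4B - A^2 are squarefree and |B| ≥ 2. Then for every integer n ≥ 0, F(x^{p^n}) is monogenic. -/
open Polynomial

/-- Reduction of an integer polynomial modulo `q`. -/
noncomputable abbrev redMod (q : ℕ) : ℤ[X] →+* (ZMod q)[X] :=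
  mapRingHom (Int.castRingHom (ZMod q))

lemma redMod_surjective (q : ℕ) : Function.Surjective (redMod q) :=
  map_surjective _ (ZMod.ringHom_surjective _)

lemma redMod_eq_zero_iff {q : ℕ} {P : ℤ[X]} : redMod q P = 0 ↔ ∃ Q, P = C (q : ℤ) * Q := by
  change _ ↔ C (q : ℤ) ∣ P
  rw [C_dvd_iff_dvd_coeff, Polynomial.ext_iff]
  simp [CharP.intCast_eq_zero_iff (ZMod q) q]

lemma exists_eq_add_of_redMod_dvd {q : ℕ} {g P : ℤ[X]} (h : redMod q g ∣ redMod q P) :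
    ∃ S T, P = g * S + C (q : ℤ) * T := by
  obtain ⟨s, hs⟩ := h
  obtain ⟨S, rfl⟩ := redMod_surjective q s
  obtain ⟨T, hT⟩ := redMod_eq_zero_iff.1 (show redMod q (P - g * S) = 0 by
    rw [map_sub, map_mul, hs, sub_self])
  exact ⟨S, T, by rw [← hT]; ring⟩

section
variable {O : Type*} [CommRing O] {θ : O} {f : ℤ[X]} {q : ℕ}

/-- If `P(θ)` is `q` times an integral element, then `f` divides a power of `P` modulo `q`. -/
lemma redMod_dvd_pow_of_aeval_eq (hf : ∀ P : ℤ[X], aeval θ P = 0 → f ∣ P) {P : ℤ[X]} {α : O}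
    (hα : IsIntegral ℤ α) (h : aeval θ P = q * α) : ∃ m, redMod q f ∣ redMod q P ^ m := by
  obtain ⟨m, hm, hm0⟩ := hα
  have h1 : aeval θ ((m.scaleRoots (q : ℤ)).comp P) = 0 := by
    rw [aeval_comp, h]
    simpa using scaleRoots_aeval_eq_zero (r := (q : ℤ)) (show aeval α m = 0 from hm0)
  refine ⟨m.natDegree, ?_⟩
  have h2 := _root_.map_dvd (redMod q) (hf _ h1)
  have h3 : redMod q (m.scaleRoots (q : ℤ)) = X ^ m.natDegree := by
    ext i
    simp only [coe_mapRingHom, coeff_map, coeff_scaleRoots, coeff_X_pow, eq_intCast]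
    rcases lt_trichotomy i m.natDegree with hi | rfl | hi
    · rw [if_neg hi.ne]
      simp [Nat.sub_ne_zero_of_lt hi]
    · simp [hm.coeff_natDegree]
    · rw [if_neg hi.ne', coeff_eq_zero_of_natDegree_lt hi]
      simp
  have h4 : redMod q ((m.scaleRoots (q : ℤ)).comp P) = redMod q P ^ m.natDegree := by
    rw [coe_mapRingHom, map_comp, ← coe_mapRingHom, h3]
    simp
  rwa [h4] at h2

/-- Dedekind's criterion at `q` for `f ≡ g ^ k * h`, with `g` and `h` coprime and squarefree
modulo `q`. -/
lemma mem_adjoin_of_natCast_mul_mem_adjoin [IsDomain O] [CharZero O] [Algebra.IsIntegral ℤ O]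
    [Fact q.Prime] (hθ : aeval θ f = 0) (hf : ∀ P : ℤ[X], aeval θ P = 0 → f ∣ P)
    {g h E : ℤ[X]} {k : ℕ} (hfe : f = g ^ k * h + C (q : ℤ) * E)
    (hg : Squarefree (redMod q g)) (hh : Squarefree (redMod q h))
    (hgh : IsCoprime (redMod q g) (redMod q h)) (hgE : IsCoprime (redMod q g) (redMod q E))
    {α : O} (hα : (q : O) * α ∈ Algebra.adjoin ℤ {θ}) : α ∈ Algebra.adjoin ℤ {θ} := by
  have hq0 : (q : O) ≠ 0 := by exact_mod_cast (Fact.out : q.Prime).ne_zero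
  have hqC : redMod q (C (q : ℤ)) = 0 := by simp
  have hfbar : redMod q f = redMod q g ^ k * redMod q h := by
    rw [hfe, map_add, map_mul, map_mul, map_pow, hqC, zero_mul, add_zero]
  rw [Algebra.adjoin_singleton_eq_range_aeval] at hα ⊢
  obtain ⟨P, hP⟩ := hα
  change aeval θ P = q * α at hP
  have hgfe : aeval θ g ^ k * aeval θ h = - (q * aeval θ E) := by
    have := hθ
    rw [hfe] at this
    simp only [map_add, map_mul, map_pow, aeval_C] at this
    simp at this
    linear_combination this
  have key : ∀ j ≤ k, redMod q g ^ j ∣ redMod q P := by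
    intro j
    induction j with
    | zero => simp
    | succ j ih =>
      intro hj
      obtain ⟨S, T, hST⟩ := exists_eq_add_of_redMod_dvd (g := g ^ j) (P := P)
        (by rw [map_pow]; exact ih (by omega))
      have h1 : aeval θ g ^ j * aeval θ S = q * (α - aeval θ T) := by
        rw [hST] at hP
        simp at hP
        linear_combination hP
      have h2 : aeval θ (E * S) = - ((α - aeval θ T) * aeval θ g ^ (k - j) * aeval θ h) := by
        apply mul_left_cancel₀ hq0
        have h3 : aeval θ g ^ k = aeval θ g ^ j * aeval θ g ^ (k - j) := by
          rw [← pow_add]; congr 1; omega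
        rw [map_mul]
        rw [h3] at hgfe
        linear_combination (aeval θ S) * hgfe - (aeval θ g ^ (k - j) * aeval θ h) * h1
      have h3 : aeval θ ((E * S) ^ k) = q * ((-1) ^ (k + 1) * (α - aeval θ T) ^ k *
          aeval θ g ^ ((k - j) * k - k) * aeval θ h ^ (k - 1) * aeval θ E) := by
        have e1 : aeval θ g ^ ((k - j) * k) = aeval θ g ^ ((k - j) * k - k) * aeval θ g ^ k := by
          rw [← pow_add, Nat.sub_add_cancel (Nat.le_mul_of_pos_left _ (by omega))]
        have e2 : aeval θ h ^ k = aeval θ h ^ (k - 1) * aeval θ h := by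
          rw [← pow_succ, Nat.sub_add_cancel (by omega)]
        rw [map_pow, h2, neg_pow, mul_pow, mul_pow, ← pow_mul, e1, e2]
        linear_combination ((-1) ^ k * (α - aeval θ T) ^ k *
          aeval θ g ^ ((k - j) * k - k) * aeval θ h ^ (k - 1)) * hgfe
      obtain ⟨m, hm⟩ := redMod_dvd_pow_of_aeval_eq hf (Algebra.IsIntegral.isIntegral _) h3
      have h4 : redMod q g ∣ redMod q E * redMod q S := by
        rw [← map_mul]
        apply hg.isRadical (k * m)
        rw [pow_mul, ← map_pow]
        refine dvd_trans ?_ hm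
        rw [hfbar]
        exact Dvd.dvd.mul_right (dvd_pow_self _ (by omega)) _
      have h5 := hgE.dvd_of_dvd_mul_left h4
      rw [hST, map_add, map_mul, map_mul, hqC, zero_mul, add_zero, map_pow, pow_succ]
      exact mul_dvd_mul_left _ h5
  obtain ⟨m, hm⟩ := redMod_dvd_pow_of_aeval_eq hf (Algebra.IsIntegral.isIntegral _) hP
  have hhP : redMod q h ∣ redMod q P :=
    hh.isRadical m _ ((Dvd.intro_left _ hfbar.symm).trans hm)
  have hfP : redMod q f ∣ redMod q P := by
    rw [hfbar]
    exact hgh.pow_left.mul_dvd (key k le_rfl) hhP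
  obtain ⟨S, T, hST⟩ := exists_eq_add_of_redMod_dvd hfP
  refine ⟨T, mul_left_cancel₀ hq0 ?_⟩
  change _ * aeval θ T = _
  rw [← hP, hST]
  simp [hθ]

/-- If all primes dividing a nonzero integer `k` can be cancelled, then so can `k`. -/
lemma mem_of_natCast_mul_mem (R : Subalgebra ℤ O) (k : ℕ) (hk : k ≠ 0)
    (hR : ∀ q : ℕ, q.Prime → q ∣ k → ∀ α : O, (q : O) * α ∈ R → α ∈ R) {α : O}
    (hα : (k : O) * α ∈ R) : α ∈ R := by
  induction k using induction_on_primes generalizing α with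
  | zero => exact absurd rfl hk
  | one => simpa using hα
  | prime_mul q k hq ih =>
    refine ih (right_ne_zero_of_mul hk) (fun r hr hrk => hR r hr (hrk.mul_left _)) ?_
    apply hR q hq (dvd_mul_right _ _)
    simpa [mul_assoc] using hα

end

lemma comp_X_pow_eq (A B : ℤ) (N : ℕ) :
    (X ^ 2 + C A * X + C B : ℤ[X]).comp (X ^ N) = X ^ (2 * N) + C A * X ^ N + C B := by
  simp [← pow_mul, mul_comm]

section
variable {A B : ℤ} {N q : ℕ}

lemma isCoprime_redMod_of_const [Fact q.Prime] (g : ℤ[X]) {E : ℤ[X]} {e : ℤ}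
    (hE : redMod q E = C (e : ZMod q)) (he : ¬ (q : ℤ) ∣ e) :
    IsCoprime (redMod q g) (redMod q E) := by
  rw [hE]
  refine (isCoprime_one_right.of_isCoprime_of_dvd_right (isUnit_iff_dvd_one.1 ?_))
  rw [isUnit_C, isUnit_iff_ne_zero, Ne, CharP.intCast_eq_zero_iff (ZMod q) q]
  exact he

lemma squarefree_redMod_X_pow_add_C [Fact q.Prime] (hN : ¬ q ∣ N) {c : ℤ} (hc : ¬ (q : ℤ) ∣ c) :
    Squarefree (redMod q (X ^ N + C c)) := by
  have := (separable_X_pow_sub_C' q N (-c : ZMod q) hN (by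
    rw [neg_ne_zero, Ne, CharP.intCast_eq_zero_iff (ZMod q) q]
    exact hc)).squarefree
  simpa using this

/-- `f` has a decomposition to which Dedekind's criterion at `q` applies. -/
def HasDedekindDecomposition (q : ℕ) (f : ℤ[X]) : Prop :=
  ∃ (g h E : ℤ[X]) (k : ℕ), f = g ^ k * h + C (q : ℤ) * E ∧ Squarefree (redMod q g) ∧
    Squarefree (redMod q h) ∧ IsCoprime (redMod q g) (redMod q h) ∧
    IsCoprime (redMod q g) (redMod q E)

lemma hasDedekindDecomposition_of_dvd_right [Fact q.Prime] (hq : (q : ℤ) ∣ B)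
    (hB : Squarefree B) (hN : ¬ q ∣ N) :
    HasDedekindDecomposition q (X ^ (2 * N) + C A * X ^ N + C B) := by
  have hqp : Prime (q : ℤ) := Nat.prime_iff_prime_int.1 Fact.out
  have hX : Irreducible (redMod q X) := by simpa using irreducible_X
  obtain ⟨b, rfl⟩ := hq
  have hb : ¬ (q : ℤ) ∣ b := fun ⟨c, hc⟩ => hqp.not_isUnit (hB _ ⟨c, by rw [hc]; ring⟩)
  have hN0 : N ≠ 0 := by rintro rfl; simp at hN
  by_cases hA : (q : ℤ) ∣ A
  · obtain ⟨a, rfl⟩ := hA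
    refine ⟨X, 1, C a * X ^ N + C b, 2 * N, ?_, hX.squarefree, by simp, by
      simpa using isCoprime_one_right, ?_⟩
    · simp only [C_mul]; ring
    · refine (hX.coprime_iff_not_dvd).2 ?_
      simp only [coe_mapRingHom, map_X, X_dvd_iff]
      simpa [hN0.symm, hN0, coeff_X_pow, CharP.intCast_eq_zero_iff (ZMod q) q] using hb
  · refine ⟨X, X ^ N + C A, C b, N, ?_, hX.squarefree, squarefree_redMod_X_pow_add_C hN hA, ?_,
      isCoprime_redMod_of_const _ (e := b) (by simp) hb⟩
    · simp only [C_mul]; ring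
    · refine (hX.coprime_iff_not_dvd).2 ?_
      simp only [coe_mapRingHom, map_X, X_dvd_iff]
      simpa [hN0.symm, hN0, coeff_X_pow, CharP.intCast_eq_zero_iff (ZMod q) q] using hA

lemma hasDedekindDecomposition_of_dvd_disc [Fact q.Prime] (hA : Odd A)
    (hq : (q : ℤ) ∣ 4 * B - A ^ 2) (hD : Squarefree (4 * B - A ^ 2)) (hqB : ¬ (q : ℤ) ∣ B)
    (hN : ¬ q ∣ N) :
    HasDedekindDecomposition q (X ^ (2 * N) + C A * X ^ N + C B) := by
  have hqp : Prime (q : ℤ) := Nat.prime_iff_prime_int.1 Fact.out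
  have hqo : Odd (q : ℤ) := by
    obtain ⟨d, hd⟩ := hq
    have h1 : Odd (q * d) := by
      rw [← hd]
      exact (Even.mul_right (by decide) B).sub_odd hA.pow
    exact (Int.odd_mul.1 h1).1
  have hq4 : IsCoprime (q : ℤ) 4 := by
    rw [show (4 : ℤ) = 2 ^ 2 by norm_num]
    exact (Int.isCoprime_two_right.2 hqo).pow_right
  have hqA : ¬ (q : ℤ) ∣ A := fun h => hqB <| hq4.dvd_of_dvd_mul_left <| by
    simpa using dvd_add hq (h.mul_left A |>.trans (dvd_of_eq (sq A).symm))
  obtain ⟨c, hc⟩ := hA.add_odd (hqo.pow (n := 2))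
  obtain ⟨d, hd⟩ := hq
  have hqd : ¬ (q : ℤ) ∣ d := fun ⟨e, he⟩ => hqp.not_isUnit (hD _ ⟨e, by rw [hd, he]; ring⟩)
  have h4 : 4 * (B - c ^ 2) = q * (d - 2 * A * q - q ^ 3) := by
    linear_combination hd + (A + q ^ 2 + 2 * c) * hc
  obtain ⟨e, he⟩ : (q : ℤ) ∣ B - c ^ 2 := hq4.dvd_of_dvd_mul_left ⟨_, h4⟩
  have hqe : ¬ (q : ℤ) ∣ e := by
    intro h
    apply hqd
    have : 4 * e = d - 2 * A * q - q ^ 3 := by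
      apply mul_left_cancel₀ hqp.ne_zero
      rw [← h4, he]; ring
    rw [show d = 4 * e + q * (2 * A + q ^ 2) by rw [this]; ring]
    exact dvd_add (h.mul_left _) (dvd_mul_right _ _)
  have hqc : ¬ (q : ℤ) ∣ c := fun h => hqA <| by
    rw [show A = 2 * c - q * q by linear_combination hc]
    exact dvd_sub (h.mul_left _) (dvd_mul_right _ _)
  refine ⟨X ^ N + C c, 1, C (-q : ℤ) * X ^ N + C e, 2, ?_, squarefree_redMod_X_pow_add_C hN hqc,
    by simp, by simpa using isCoprime_one_right,
    isCoprime_redMod_of_const _ (e := e) (by simp) hqe⟩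
  rw [show A = 2 * c - q * q by linear_combination hc, show B = c ^ 2 + q * e by
    linear_combination he]
  simp only [C_mul, C_add, C_sub, C_pow, C_neg, C_ofNat]
  ring

end

section
variable {A B : ℤ} {p : ℕ} [Fact p.Prime]

lemma redMod_eq_X_add_one_pow (hA : (p : ℤ) ∣ A - 2) (hB : (p : ℤ) ∣ B - 1) (n : ℕ) :
    redMod p (X ^ (2 * p ^ n) + C A * X ^ p ^ n + C B) =
      redMod p (X - C (-1)) ^ (2 * p ^ n) := by
  have hA' : (A : ZMod p) = 2 := by
    have := (CharP.intCast_eq_zero_iff (ZMod p) p _).2 hA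
    push_cast at this
    linear_combination this
  have hB' : (B : ZMod p) = 1 := by
    have := (CharP.intCast_eq_zero_iff (ZMod p) p _).2 hB
    push_cast at this
    linear_combination this
  rw [mul_comm 2, pow_mul (redMod p (X - C (-1)))]
  have hX : redMod p (X - C (-1)) = X + 1 := by simp
  have hC (c : ℤ) : redMod p (C c) = C (c : ZMod p) := by simp
  rw [hX, map_add, map_add, map_mul, map_pow, map_pow, hC, hC, hA', hB', add_pow_char_pow,
    show redMod p X = X by simp, C_1, show C (2 : ZMod p) = 2 from C_ofNat 2]
  ring

lemma monic_and_natDegree_pos (n : ℕ) :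
    (X ^ (2 * p ^ n) + C A * X ^ p ^ n + C B : ℤ[X]).Monic ∧
      0 < (X ^ (2 * p ^ n) + C A * X ^ p ^ n + C B : ℤ[X]).natDegree := by
  have hN : 0 < p ^ n := pow_pos (Fact.out : p.Prime).pos n
  rw [← comp_X_pow_eq]
  have h2 : (X ^ 2 + C A * X + C B : ℤ[X]).natDegree = 2 := by compute_degree!
  constructor
  · refine Monic.comp ?_ (monic_X_pow _) (by simpa using hN.ne')
    monicity!
  · rw [natDegree_comp, h2]
    simpa using hN

variable (hp2 : p ≠ 2)
include hp2

lemma eval_neg_one_eq (n : ℕ) :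
    eval (-1) (X ^ (2 * p ^ n) + C A * X ^ p ^ n + C B : ℤ[X]) = 1 - A + B := by
  have : Odd (p ^ n) := ((Fact.out : p.Prime).odd_of_ne_two hp2).pow
  simp [pow_mul, this.neg_one_pow]
  ring

lemma hasDedekindDecomposition_self (hA : (p : ℤ) ∣ A - 2) (hB : (p : ℤ) ∣ B - 1) {e : ℤ}
    (he : 1 - A + B = p * e) (hpe : ¬ (p : ℤ) ∣ e) (n : ℕ) :
    HasDedekindDecomposition p (X ^ (2 * p ^ n) + C A * X ^ p ^ n + C B) := by
  have hX : Irreducible (redMod p (X - C (-1))) := by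
    simpa using irreducible_X_sub_C (-1 : ZMod p)
  obtain ⟨E, hE⟩ := redMod_eq_zero_iff.1 (show redMod p (X ^ (2 * p ^ n) + C A * X ^ p ^ n + C B -
    (X - C (-1)) ^ (2 * p ^ n)) = 0 by
      rw [map_sub, redMod_eq_X_add_one_pow hA hB, map_pow, sub_self])
  refine ⟨X - C (-1), 1, E, 2 * p ^ n, by rw [← hE]; ring, hX.squarefree, by simp,
    by simpa using isCoprime_one_right, hX.coprime_iff_not_dvd.2 ?_⟩
  have h1 := congrArg (eval (-1)) hE
  rw [eval_sub, eval_neg_one_eq hp2, he] at h1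
  have h2 : e = E.eval (-1) := by
    apply mul_left_cancel₀ (show (p : ℤ) ≠ 0 by exact_mod_cast (Fact.out : p.Prime).ne_zero)
    simpa [(Fact.out : p.Prime).ne_zero] using h1
  have h3 : (redMod p E).eval (-1) = (e : ZMod p) := by
    rw [h2]
    simpa using eval_intCast_map (Int.castRingHom (ZMod p)) E (-1)
  have h4 : redMod p (X - C (-1)) = X - C (-1) := by simp
  rw [h4, dvd_iff_isRoot, IsRoot, h3, CharP.intCast_eq_zero_iff (ZMod p) p]
  exact hpe

lemma irreducible_of_generalizedEisenstein (hA : (p : ℤ) ∣ A - 2) (hB : (p : ℤ) ∣ B - 1) {e : ℤ}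
    (he : 1 - A + B = p * e) (hpe : ¬ (p : ℤ) ∣ e) (n : ℕ) :
    Irreducible (X ^ (2 * p ^ n) + C A * X ^ p ^ n + C B : ℤ[X]) := by
  obtain ⟨hm, hd⟩ := monic_and_natDegree_pos (A := A) (p := p) (B := B) n
  refine generalizedEisenstein (K := ZMod p) (q := X - C (-1)) (p := 2 * p ^ n)
    (by simpa using irreducible_X_sub_C (-1 : ZMod p)) (monic_X_sub_C _) hm.isPrimitive hd
    (by rw [hm.leadingCoeff, map_one]; exact one_ne_zero) ?_ ?_
  · rw [hm.leadingCoeff, map_one, C_1, one_mul]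
    exact redMod_eq_X_add_one_pow hA hB n
  · rw [modByMonic_X_sub_C_eq_C_eval, eval_neg_one_eq hp2, he, map_C, Ne, C_eq_zero,
      Ideal.Quotient.eq_zero_iff_mem, show RingHom.ker (algebraMap ℤ (ZMod p)) = _ from
        ZMod.ker_intCastRingHom p, Ideal.span_singleton_pow, Ideal.mem_span_singleton, sq]
    exact fun h => hpe
      ((mul_dvd_mul_iff_left (by exact_mod_cast (Fact.out : p.Prime).ne_zero)).1 h)

end

lemma aeval_derivative_mul_eq {O : Type*} [CommRing O] {θ : O} {A B : ℤ} {N : ℕ} (hN : 0 < N)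
    (hθ : aeval θ (X ^ (2 * N) + C A * X ^ N + C B : ℤ[X]) = 0) :
    aeval θ (derivative (X ^ (2 * N) + C A * X ^ N + C B : ℤ[X])) *
      ((2 * θ ^ N + A) * (θ * (θ ^ N + A))) = ((N * (4 * B - A ^ 2) * B : ℤ) : O) := by
  obtain ⟨M, rfl⟩ : ∃ M, N = M + 1 := ⟨N - 1, by omega⟩
  have h1 : θ ^ (2 * (M + 1) - 1) = θ ^ M * θ ^ (M + 1) := by
    rw [← pow_add]; congr 1; omega
  have h2 : (θ ^ (M + 1)) ^ 2 + A * θ ^ (M + 1) + B = 0 := by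
    simpa [← pow_mul, mul_comm] using hθ
  have h3 : aeval θ (derivative (X ^ (2 * (M + 1)) + C A * X ^ (M + 1) + C B : ℤ[X])) =
      ((M : O) + 1) * θ ^ M * (2 * θ ^ (M + 1) + A) := by
    simp only [derivative_X_pow, derivative_C_mul_X_pow, derivative_C, map_add,
      map_mul, map_pow, aeval_X, aeval_C, map_natCast, map_zero, h1]
    simp only [eq_intCast, algebraMap_int_eq]
    push_cast
    ring
  rw [h3]
  rw [show ((M : O) + 1) * θ ^ M * (2 * θ ^ (M + 1) + A) *
    ((2 * θ ^ (M + 1) + A) * (θ * (θ ^ (M + 1) + A))) = ((M : O) + 1) *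
      (2 * θ ^ (M + 1) + A) ^ 2 * (θ ^ (M + 1) * (θ ^ (M + 1) + A)) by ring]
  generalize θ ^ (M + 1) = y at h2
  push_cast
  linear_combination ((M : O) + 1) * (4 * y * (y + A) + A ^ 2 - 4 * B) * h2

lemma aeval_derivative_minpoly_mem_conductor {K : Type*} [Field K] [NumberField K]
    (θ : NumberField.RingOfIntegers K) (h : Algebra.adjoin ℚ {(θ : K)} = ⊤) :
    aeval θ (derivative (minpoly ℤ θ)) ∈ conductor ℤ θ := by
  have h1 := conductor_mul_differentIdeal ℤ ℚ K θ h
  have h2 := Ideal.mem_span_singleton_self (aeval θ (derivative (minpoly ℤ θ)))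
  rw [← h1] at h2
  exact Ideal.mul_le_left h2

theorem stmt_12 (p : ℕ) (hp : p.Prime) (hp3 : 3 ≤ p) (u t : ℤ) (A B : ℤ)
    (hA : A = 4 * p * u + (p : ℤ) ^ 2 + 2) (hB : B = 2 * p * t + 1)
    (hBsf : Squarefree B) (hB1sf : Squarefree (B - 1))
    (hDsf : Squarefree (4 * B - A ^ 2)) (hB2 : 2 ≤ |B|) (n : ℕ) :
    Irreducible (((X ^ 2 + C A * X + C B : Polynomial ℤ).comp (X ^ p ^ n)).map
        (Int.castRingHom ℚ)) ∧
      ∀ (K : Type) [Field K] [NumberField K] (θ : NumberField.RingOfIntegers K),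
        Polynomial.aeval (θ : K) ((X ^ 2 + C A * X + C B : Polynomial ℤ).comp (X ^ p ^ n)) = 0 →
        Algebra.adjoin ℚ {(θ : K)} = ⊤ →
        Algebra.adjoin ℤ {θ} = ⊤ := by
  have := Fact.mk hp
  have hp2 : p ≠ 2 := by omega
  have hpp : Prime (p : ℤ) := Nat.prime_iff_prime_int.1 hp
  have hpodd : Odd (p : ℤ) := by exact_mod_cast hp.odd_of_ne_two hp2
  have hA' : (p : ℤ) ∣ A - 2 := ⟨4 * u + p, by rw [hA]; ring⟩
  have hB' : (p : ℤ) ∣ B - 1 := ⟨2 * t, by rw [hB]; ring⟩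
  have hAodd : Odd A := by
    have : Odd ((p : ℤ) ^ 2) := hpodd.pow
    rw [hA, show 4 * p * u + (p : ℤ) ^ 2 + 2 = (p : ℤ) ^ 2 + 2 * (2 * p * u + 1) by ring]
    exact this.add_even (even_two_mul _)
  obtain ⟨e, he, hpe⟩ : ∃ e : ℤ, 1 - A + B = p * e ∧ ¬ (p : ℤ) ∣ e := by
    refine ⟨2 * t - 4 * u - p, by rw [hA, hB]; ring, fun ⟨s, hs⟩ => hpp.not_isUnit (hDsf _
      ⟨4 * s - (4 * u + p) ^ 2, ?_⟩)⟩
    rw [hA, hB]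
    linear_combination 4 * (p : ℤ) * hs
  rw [comp_X_pow_eq]
  obtain ⟨hm, -⟩ := monic_and_natDegree_pos (A := A) (p := p) (B := B) n
  have hirr := irreducible_of_generalizedEisenstein hp2 hA' hB' he hpe n
  refine ⟨(hm.irreducible_iff_irreducible_map_fraction_map (K := ℚ)).1 hirr, ?_⟩
  intro K _ _ θ hθK hadj
  have hθ : aeval θ (X ^ (2 * p ^ n) + C A * X ^ p ^ n + C B : ℤ[X]) = 0 := by
    apply NumberField.RingOfIntegers.coe_injective
    rw [map_zero, ← hθK]
    exact (aeval_algebraMap_apply K θ _).symm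
  have hint : IsIntegral ℤ θ := Algebra.IsIntegral.isIntegral θ
  have hmin : minpoly ℤ θ = X ^ (2 * p ^ n) + C A * X ^ p ^ n + C B :=
    eq_of_monic_of_associated (minpoly.monic hint) hm
      ((minpoly.irreducible hint).associated_of_dvd hirr (minpoly.isIntegrallyClosed_dvd hint hθ))
  have hcond : (((p ^ n : ℕ) * (4 * B - A ^ 2) * B : ℤ) : NumberField.RingOfIntegers K) ∈
      conductor ℤ θ := by
    have h1 := aeval_derivative_minpoly_mem_conductor θ hadj
    rw [hmin] at h1
    rw [← aeval_derivative_mul_eq (pow_pos hp.pos n) hθ]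
    exact Ideal.mul_mem_right _ _ h1
  rw [eq_top_iff]
  rintro α -
  have hk0 : ((p ^ n : ℕ) * (4 * B - A ^ 2) * B : ℤ) ≠ 0 :=
    mul_ne_zero (mul_ne_zero (by exact_mod_cast (pow_pos hp.pos n).ne') hDsf.ne_zero) hBsf.ne_zero
  refine mem_of_natCast_mul_mem _ _ (Int.natAbs_ne_zero.2 hk0) ?_ (?_ : _ * α ∈ _)
  · intro q hq hqk β hβ
    have := Fact.mk hq
    obtain ⟨g, h, E, k, hfe, hg, hh, hgh, hgE⟩ :
        HasDedekindDecomposition q (X ^ (2 * p ^ n) + C A * X ^ p ^ n + C B) := by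
      by_cases hqp : q = p
      · subst hqp
        exact hasDedekindDecomposition_self hp2 hA' hB' he hpe n
      have hN : ¬ q ∣ p ^ n := fun h => hqp ((Nat.prime_dvd_prime_iff_eq hq hp).1
        (hq.dvd_of_dvd_pow h))
      by_cases hqB : (q : ℤ) ∣ B
      · exact hasDedekindDecomposition_of_dvd_right hqB hBsf hN
      · refine hasDedekindDecomposition_of_dvd_disc hAodd ?_ hDsf hqB hN
        have hqi : Prime (q : ℤ) := Nat.prime_iff_prime_int.1 hq
        rcases hqi.dvd_or_dvd (Int.natCast_dvd.2 hqk) with h | h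
        · exact (hqi.dvd_or_dvd h).resolve_left (by exact_mod_cast hN)
        · exact absurd h hqB
    exact mem_adjoin_of_natCast_mul_mem_adjoin hθ
      (fun P hP => hmin ▸ minpoly.isIntegrallyClosed_dvd hint hP) hfe hg hh hgh hgE hβ
  · have h1 := hcond α
    rw [← Int.cast_natCast]
    rcases Int.natAbs_eq ((p ^ n : ℕ) * (4 * B - A ^ 2) * B : ℤ) with h | h
    · rwa [← h]
    · rw [eq_neg_iff_add_eq_zero, add_comm, ← eq_neg_iff_add_eq_zero] at h
      rw [h, Int.cast_neg, neg_mul]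
      exact neg_mem h1
end

section
/- Let K ⊂ L be number fields. Then Δ(K)^{[L:K]} divides Δ(L), where Δ denotes the absolute discriminant of a number field. -/
theorem stmt_15 (K L : Type*) [Field K] [NumberField K] [Field L] [NumberField L]
    [Algebra K L] :
    (NumberField.discr K) ^ Module.finrank K L ∣ NumberField.discr L := by
  rw [← Int.natAbs_dvd_natAbs, Int.natAbs_pow,
    NumberField.natAbs_discr_eq_absNorm_differentIdeal_mul_natAbs_discr_pow K
      (NumberField.RingOfIntegers K) L (NumberField.RingOfIntegers L)]
  exact dvd_mul_left _ _
end

section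
/- Let p ≥ 3 be prime and let u ∈ ℤ. Define G(t) = p(2pt+1)(8t - 16pu^2 - 8p^2u - 16u - 4p - p^3). Then there exist infinitely many primes ρ such that G(ρ) is squarefree. -/
open ArithmeticFunction Filter Topology
open vonMangoldt (residueClass residueClass_nonneg residueClass_le)

lemma summable_vonMangoldt_div_rpow {s : ℝ} (hs : 1 < s) :
    Summable fun n : ℕ ↦ Λ n / (n : ℝ) ^ s := by
  refine LSeries.summable_real_of_abscissaOfAbsConv_lt (lt_of_le_of_lt ?_ (EReal.coe_lt_coe_iff.mpr hs))
  exact LSeries.abscissaOfAbsConv_le_of_forall_lt_LSeriesSummable fun y hy ↦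
    LSeriesSummable_vonMangoldt (by simpa using hy)

lemma summable_residueClass_div_rpow {q : ℕ} (a : ZMod q) {s : ℝ} (hs : 1 < s) :
    Summable fun n : ℕ ↦ residueClass a n / (n : ℝ) ^ s :=
  (summable_vonMangoldt_div_rpow hs).of_nonneg_of_le
    (fun n ↦ div_nonneg (residueClass_nonneg a n) (by positivity))
    (fun n ↦ div_le_div_of_nonneg_right (residueClass_le a n) (by positivity))

lemma summable_vonMangoldt_mul {s : ℝ} (hs : 1 < s) {g : ℕ → ℝ}
    (hg0 : ∀ n, 0 ≤ g n) (hg1 : ∀ n, g n ≤ 1) :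
    Summable fun x : ℕ × ℕ ↦ Λ x.1 / (x.1 : ℝ) ^ s * (g (x.1 * x.2) / (x.2 : ℝ) ^ s) := by
  have hΛ (n : ℕ) : 0 ≤ Λ n := vonMangoldt_nonneg
  refine ((summable_vonMangoldt_div_rpow hs).mul_of_nonneg
    (Real.summable_one_div_nat_rpow.mpr hs) (fun n ↦ ?_) (fun n ↦ ?_)).of_nonneg_of_le
    (fun x ↦ ?_) (fun x ↦ ?_)
  · exact div_nonneg (hΛ n) (by positivity)
  · show (0 : ℝ) ≤ 1 / (n : ℝ) ^ s
    positivity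
  · exact mul_nonneg (div_nonneg (hΛ _) (by positivity)) (div_nonneg (hg0 _) (by positivity))
  · refine mul_le_mul_of_nonneg_left ?_ (div_nonneg (hΛ _) (by positivity))
    exact div_le_div_of_nonneg_right (hg1 _) (by positivity)

/-- The identity `Λ * 1 = log`, twisted by an arbitrary weight on the product. -/
lemma hasSum_mul_log_div_rpow {s : ℝ} (hs : 1 < s) {g : ℕ → ℝ}
    (hg0 : ∀ n, 0 ≤ g n) (hg1 : ∀ n, g n ≤ 1) :
    HasSum (fun m : ℕ ↦ g m * Real.log m / (m : ℝ) ^ s)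
      (∑' d : ℕ, Λ d / (d : ℝ) ^ s * ∑' e : ℕ, g (d * e) / (e : ℝ) ^ s) := by
  have hsum := summable_vonMangoldt_mul hs hg0 hg1
  have hs0 : s ≠ 0 := by positivity
  have key := hsum.hasSum.tsum_fiberwise (fun x : ℕ × ℕ ↦ x.1 * x.2)
  rw [hsum.tsum_prod] at key
  simp only [tsum_mul_left] at key
  convert! key using 1
  funext m
  rcases eq_or_ne m 0 with rfl | hm
  · have (p : (fun x : ℕ × ℕ ↦ x.1 * x.2) ⁻¹' {0}) :
        Λ p.1.1 / (p.1.1 : ℝ) ^ s * (g (p.1.1 * p.1.2) / (p.1.2 : ℝ) ^ s) = 0 := by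
      obtain ⟨⟨a, b⟩, hp⟩ := p
      have hp : a * b = 0 := hp
      rcases Nat.mul_eq_zero.mp hp with rfl | rfl <;> simp [hs0]
    simp [this]
  · rw [show (fun x : ℕ × ℕ ↦ x.1 * x.2) ⁻¹' {m} = m.divisorsAntidiagonal by ext; simp [hm],
      Finset.tsum_subtype' m.divisorsAntidiagonal
        fun x : ℕ × ℕ ↦ Λ x.1 / (x.1 : ℝ) ^ s * (g (x.1 * x.2) / (x.2 : ℝ) ^ s),
      ← vonMangoldt_sum, ← Nat.sum_divisorsAntidiagonal (fun i _ ↦ Λ i), Finset.mul_sum,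
      Finset.sum_div]
    refine Finset.sum_congr rfl fun x hx ↦ ?_
    obtain ⟨hx, -⟩ := Nat.mem_divisorsAntidiagonal.mp hx
    rw [hx, ← hx, Nat.cast_mul, Real.mul_rpow (by positivity) (by positivity)]
    ring

lemma hasSum_one_div_mul_succ_rpow (s : ℝ) (hs : 1 < s) (k : ℕ) :
    HasSum (fun j : ℕ ↦ 1 / ((k * (j + 1) : ℕ) : ℝ) ^ s)
      (1 / (k : ℝ) ^ s * ∑' n : ℕ, 1 / (n : ℝ) ^ s) := by
  have h := Real.summable_one_div_nat_rpow.mpr hs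
  have h0 : s ≠ 0 := by positivity
  have h1 := ((hasSum_nat_add_iff' 1).mpr h.hasSum).mul_left (1 / (k : ℝ) ^ s)
  simp only [Finset.range_one, Finset.sum_singleton, Nat.cast_zero, Real.zero_rpow h0, div_zero,
    sub_zero] at h1
  refine h1.congr_fun ?_
  intro j
  rw [Nat.cast_mul, Real.mul_rpow (by positivity) (by positivity)]
  field_simp

/-- The terms `c + k * j` of a residue class are at most `k * (j + 1)`. -/
lemma le_tsum_residue_rpow {s : ℝ} (hs : 1 < s) {k c : ℕ} (hk : 2 ≤ k) (hc : 1 ≤ c)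
    (hck : c ≤ k) {P : ℕ → Prop} [DecidablePred P] (hP : ∀ j, P (c + k * j)) :
    1 / (k : ℝ) ^ s * ∑' n : ℕ, 1 / (n : ℝ) ^ s + (1 / (c : ℝ) ^ s - 1 / (k : ℝ) ^ s) ≤
      ∑' e : ℕ, (if P e then 1 else 0) / (e : ℝ) ^ s := by
  have hf0 (e : ℕ) : 0 ≤ (if P e then (1 : ℝ) else 0) / (e : ℝ) ^ s := by
    split_ifs <;> positivity
  have hf : Summable fun e : ℕ ↦ (if P e then (1 : ℝ) else 0) / (e : ℝ) ^ s :=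
    (Real.summable_one_div_nat_rpow.mpr hs).of_nonneg_of_le hf0 fun e ↦
      div_le_div_of_nonneg_right (by split_ifs <;> norm_num) (by positivity)
  have hinj : Function.Injective fun j : ℕ ↦ c + k * j := fun i j hij ↦ by
    have : k * i = k * j := by simpa using hij
    exact Nat.eq_of_mul_eq_mul_left (by lia) this
  refine le_trans ?_ (tsum_comp_le_tsum_of_inj hf hf0 hinj)
  have h1 := hasSum_one_div_mul_succ_rpow s hs k
  have h2 := h1.add (hasSum_ite_eq (0 : ℕ) (1 / (c : ℝ) ^ s - 1 / (k : ℝ) ^ s))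
  refine hasSum_le (fun j ↦ ?_) h2 (hf.comp_injective hinj).hasSum
  simp only [Function.comp, hP, if_true]
  rcases eq_or_ne j 0 with rfl | hj
  · simp
  · simp only [hj, if_false, add_zero]
    refine one_div_le_one_div_of_le (by positivity) ?_
    refine Real.rpow_le_rpow (by positivity) ?_ (by positivity)
    have : c + k * j ≤ k * (j + 1) := by rw [mul_add]; lia
    exact_mod_cast this

/-- Prime powers sharing a factor with `k` contribute at most `log k`. -/
lemma tsum_not_coprime_le {s : ℝ} (hs : 1 < s) {k : ℕ} (hk : k ≠ 0) :
    ∑' d : ℕ, (if d.Coprime k then 0 else Λ d / (d : ℝ) ^ s) ≤ Real.log k := by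
  have hΛ (n : ℕ) : 0 ≤ Λ n := vonMangoldt_nonneg
  have hprime (p : ℕ) (hp : p ∈ k.primeFactors) : HasSum
      ((Set.range fun j : ℕ ↦ p ^ (j + 1)).indicator fun d : ℕ ↦ Real.log p / d)
      (Real.log p / (p - 1)) := by
    have hp := Nat.prime_of_mem_primeFactors hp
    have hp1 : (1 : ℝ) < p := mod_cast hp.one_lt
    have hinj : Function.Injective fun j : ℕ ↦ p ^ (j + 1) := fun i j hij ↦ by
      simpa using Nat.pow_right_injective hp.two_le hij
    rw [← hinj.hasSum_iff fun x hx ↦ Set.indicator_of_notMem hx _]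
    have hgeo := (hasSum_geometric_of_lt_one (r := (p : ℝ)⁻¹) (by positivity)
      (inv_lt_one_of_one_lt₀ hp1)).mul_left (Real.log p / p)
    convert! hgeo using 1
    · funext j
      simp only [Function.comp, Set.indicator_of_mem (Set.mem_range_self j)]
      push_cast
      rw [inv_pow, pow_succ]
      field_simp
    · have : (p : ℝ) - 1 ≠ 0 := by linarith
      field_simp
  have hnonneg (p d : ℕ) :
      0 ≤ (Set.range fun j : ℕ ↦ p ^ (j + 1)).indicator (fun d : ℕ ↦ Real.log p / d) d :=
    Set.indicator_apply_nonneg fun _ ↦ by positivity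
  have hpoint (d : ℕ) : (if d.Coprime k then 0 else Λ d / (d : ℝ) ^ s) ≤
      ∑ p ∈ k.primeFactors,
        (Set.range fun j : ℕ ↦ p ^ (j + 1)).indicator (fun d : ℕ ↦ Real.log p / d) d := by
    have h0 := Finset.sum_nonneg fun p (_ : p ∈ k.primeFactors) ↦ hnonneg p d
    split_ifs with hd
    · exact h0
    by_cases hpp : IsPrimePow d
    · obtain ⟨p, m, hp, hm, rfl⟩ := (isPrimePow_nat_iff _).mp hpp
      have hpk : p ∣ k := by
        by_contra h
        exact hd (Nat.Coprime.pow_left _ ((hp.coprime_iff_not_dvd).mpr h))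
      refine le_trans ?_ (Finset.single_le_sum (fun p _ ↦ hnonneg p _)
        (Nat.mem_primeFactors.mpr ⟨hp, hpk, hk⟩))
      have hmem : p ^ m ∈ Set.range fun j : ℕ ↦ p ^ (j + 1) :=
        ⟨m - 1, by simp [Nat.sub_add_cancel hm]⟩
      rw [Set.indicator_of_mem hmem,
        vonMangoldt_apply_pow hm.ne', vonMangoldt_apply_prime hp]
      have h1 : (1 : ℝ) ≤ (p ^ m : ℕ) := mod_cast Nat.one_le_pow _ _ hp.pos
      refine div_le_div_of_nonneg_left (by positivity) (by linarith) ?_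
      simpa using Real.rpow_le_rpow_of_exponent_le h1 hs.le
    · rwa [(vonMangoldt_eq_zero_iff).mpr hpp, zero_div]
  have hsum := hasSum_sum hprime
  have hsum' : Summable fun d : ℕ ↦ (if d.Coprime k then 0 else Λ d / (d : ℝ) ^ s) :=
    hsum.summable.of_nonneg_of_le
      (fun d ↦ by split_ifs; exacts [le_rfl, div_nonneg (hΛ d) (by positivity)]) hpoint
  calc _ ≤ ∑ p ∈ k.primeFactors, Real.log p / ((p : ℝ) - 1) :=
        hasSum_le hpoint hsum'.hasSum hsum
    _ ≤ ∑ p ∈ k.primeFactors, Λ p := by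
        refine Finset.sum_le_sum fun p hp ↦ ?_
        have hp := Nat.prime_of_mem_primeFactors hp
        have hp2 : (2 : ℝ) ≤ p := mod_cast hp.two_le
        rw [vonMangoldt_apply_prime hp]
        exact div_le_self (Real.log_nonneg (by linarith)) (by linarith)
    _ ≤ ∑ p ∈ k.divisors, Λ p := Finset.sum_le_sum_of_subset_of_nonneg
        (fun p hp ↦ Nat.mem_divisors.mpr ⟨Nat.dvd_of_mem_primeFactors hp, hk⟩) fun p _ _ ↦ hΛ p
    _ = Real.log k := vonMangoldt_sum

lemma summable_log_div_rpow {s : ℝ} (hs : 1 < s) :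
    Summable fun m : ℕ ↦ Real.log m / (m : ℝ) ^ s := by
  simpa using (hasSum_mul_log_div_rpow hs (g := fun _ ↦ 1) (by simp) (by simp)).summable

lemma tsum_residue_log_le {s : ℝ} (hs : 1 < s) {k b : ℕ} (hk : 2 ≤ k) (hb : 1 ≤ b)
    (hbk : b < k) :
    ∑' m : ℕ, (if (m : ZMod k) = b then 1 else 0) * Real.log m / (m : ℝ) ^ s ≤
      Real.log b / (b : ℝ) ^ s + 1 / (k : ℝ) ^ s *
        (Real.log (2 * k) * ∑' n : ℕ, 1 / (n : ℝ) ^ s +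
          ∑' m : ℕ, Real.log m / (m : ℝ) ^ s) := by
  have hs0 : s ≠ 0 := by positivity
  have hinj : Function.Injective fun j : ℕ ↦ b + k * j := fun i j hij ↦ by
    have : k * i = k * j := by simpa using hij
    exact Nat.eq_of_mul_eq_mul_left (by lia) this
  have hsupp : Function.support (fun m : ℕ ↦
      (if (m : ZMod k) = b then 1 else 0) * Real.log m / (m : ℝ) ^ s) ⊆
      Set.range fun j : ℕ ↦ b + k * j := by
    intro m hm
    have hmb : (m : ZMod k) = b := by
      by_contra h
      simp [h] at hm
    rw [ZMod.natCast_eq_natCast_iff', Nat.mod_eq_of_lt hbk] at hmb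
    exact ⟨m / k, by rw [← hmb]; exact Nat.mod_add_div m k⟩
  have hsm : Summable fun m : ℕ ↦
      (if (m : ZMod k) = b then 1 else 0) * Real.log m / (m : ℝ) ^ s :=
    (hasSum_mul_log_div_rpow hs (g := fun m : ℕ ↦ if (m : ZMod k) = b then 1 else 0)
      (fun n ↦ by split_ifs <;> norm_num) (fun n ↦ by split_ifs <;> norm_num)).summable
  have hzero := (hsm.comp_injective hinj).tsum_eq_zero_add
  simp only [Function.comp] at hzero
  rw [← hinj.tsum_eq hsupp, hzero]
  have hZ := (hasSum_nat_add_iff' 1).mpr (Real.summable_one_div_nat_rpow.mpr hs).hasSum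
  have hL := (hasSum_nat_add_iff' 1).mpr (summable_log_div_rpow hs).hasSum
  simp only [Finset.range_one, Finset.sum_singleton, Nat.cast_zero, Real.zero_rpow hs0, div_zero,
    sub_zero] at hZ hL
  refine add_le_add (by simp) ?_
  refine hasSum_le (fun j ↦ ?_) ((summable_nat_add_iff 1).mpr (hsm.comp_injective hinj)).hasSum
    (((hZ.mul_left (Real.log (2 * k))).add hL).mul_left (1 / (k : ℝ) ^ s))
  have hk0 : (0 : ℝ) < k := by positivity
  have hlog : Real.log ((b + k * (j + 1) : ℕ) : ℝ) ≤
      Real.log (2 * k) + Real.log ((j + 1 : ℕ) : ℝ) := by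
    rw [← Real.log_mul (by positivity) (by positivity)]
    refine Real.log_le_log (by positivity) ?_
    have : b + k * (j + 1) ≤ 2 * k * (j + 1) := by nlinarith
    exact_mod_cast this
  have hlog0 : 0 ≤ Real.log ((b + k * (j + 1) : ℕ) : ℝ) := Real.log_natCast_nonneg _
  have hle : ((k * (j + 1) : ℕ) : ℝ) ^ s ≤ ((b + k * (j + 1) : ℕ) : ℝ) ^ s :=
    Real.rpow_le_rpow (by positivity) (mod_cast Nat.le_add_left _ _) (by positivity)
  have hpos : (0 : ℝ) < ((k * (j + 1) : ℕ) : ℝ) ^ s := by positivity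
  calc _ = Real.log ((b + k * (j + 1) : ℕ) : ℝ) / ((b + k * (j + 1) : ℕ) : ℝ) ^ s := by simp
    _ ≤ (Real.log (2 * k) + Real.log ((j + 1 : ℕ) : ℝ)) / ((k * (j + 1) : ℕ) : ℝ) ^ s := by
        gcongr
        exact hlog0.trans hlog
    _ = _ := by
        rw [Nat.cast_mul, Real.mul_rpow (by positivity) (by positivity)]
        field_simp

/-- An upper bound for primes in a residue class, uniform in the modulus up to a logarithm. -/
lemma tsum_residueClass_le {s : ℝ} (hs : 1 < s) {k b : ℕ} (hk : 2 ≤ k) (hb : 1 ≤ b)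
    (hbk : b < k) (hco : b.Coprime k) :
    ∑' n : ℕ, residueClass (b : ZMod k) n / (n : ℝ) ^ s ≤
      2 * (Real.log b / (b : ℝ) ^ s + 1 / (k : ℝ) ^ s *
        ((Real.log (2 * k) + Real.log k) * ∑' n : ℕ, 1 / (n : ℝ) ^ s)) := by
  have hΛ (n : ℕ) : 0 ≤ Λ n := vonMangoldt_nonneg
  have hk0 : (0 : ℝ) < k := by positivity
  set Z := ∑' n : ℕ, 1 / (n : ℝ) ^ s with hZ
  have hZ0 : 0 ≤ Z := tsum_nonneg fun n ↦ by positivity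
  set g : ℕ → ℝ := fun m ↦ if (m : ZMod k) = b then 1 else 0 with hg
  have hg0 (n : ℕ) : 0 ≤ g n := by simp only [hg]; split_ifs <;> norm_num
  have hg1 (n : ℕ) : g n ≤ 1 := by simp only [hg]; split_ifs <;> norm_num
  have hlow (d : ℕ) :
      1 / (k : ℝ) ^ s * Z * (Λ d / (d : ℝ) ^ s - if d.Coprime k then 0 else Λ d / (d : ℝ) ^ s) +
        (1 - 1 / (k : ℝ) ^ s) * (residueClass (b : ZMod k) d / (d : ℝ) ^ s) ≤
      Λ d / (d : ℝ) ^ s * ∑' e : ℕ, g (d * e) / (e : ℝ) ^ s := by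
    have ht0 : 0 ≤ ∑' e : ℕ, g (d * e) / (e : ℝ) ^ s :=
      tsum_nonneg fun e ↦ div_nonneg (hg0 _) (by positivity)
    have hw0 : 0 ≤ Λ d / (d : ℝ) ^ s := div_nonneg (hΛ d) (by positivity)
    by_cases hd : d.Coprime k
    · by_cases hdb : (d : ZMod k) = b
      · have := le_tsum_residue_rpow hs hk le_rfl (by lia)
          (P := fun e ↦ ((d * e : ℕ) : ZMod k) = b) (fun j ↦ by simp [hdb])
        rw [residueClass, Set.indicator_of_mem (by exact hdb), if_pos hd]
        refine le_trans (le_of_eq ?_) (mul_le_mul_of_nonneg_left this hw0)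
        rw [← hZ, Nat.cast_one, Real.one_rpow]
        ring
      · have : NeZero k := ⟨by lia⟩
        obtain ⟨c, hc1, hck, hc⟩ : ∃ c : ℕ, 1 ≤ c ∧ c ≤ k ∧ (d : ZMod k) * c = b := by
          have hu : (d : ZMod k) * (d : ZMod k)⁻¹ = 1 := ZMod.coe_mul_inv_eq_one d hd
          refine ⟨((d : ZMod k)⁻¹ * b).val, ?_, (ZMod.val_lt _).le, ?_⟩
          · rw [Nat.one_le_iff_ne_zero, Ne, ZMod.val_eq_zero]
            intro h
            have hb0 : (b : ZMod k) = 0 := by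
              rw [← one_mul (b : ZMod k), ← hu, mul_assoc, h, mul_zero]
            rw [ZMod.natCast_eq_zero_iff] at hb0
            exact absurd (Nat.le_of_dvd hb hb0) (by lia)
          · rw [ZMod.natCast_zmod_val, ← mul_assoc, hu, one_mul]
        have := le_tsum_residue_rpow hs hk hc1 hck
          (P := fun e ↦ ((d * e : ℕ) : ZMod k) = b) (fun j ↦ by simp [mul_add, hc])
        have hcs : 1 / (k : ℝ) ^ s ≤ 1 / (c : ℝ) ^ s := by gcongr
        rw [residueClass, Set.indicator_of_notMem (by exact hdb), if_pos hd]
        have h2 := mul_le_mul_of_nonneg_left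
          ((le_add_of_nonneg_right (sub_nonneg.mpr hcs)).trans this) hw0
        refine le_trans (le_of_eq ?_) h2
        ring
    · have hdb : (d : ZMod k) ≠ b := fun h ↦ by
        rw [ZMod.natCast_eq_natCast_iff] at h
        exact hd (by rw [Nat.Coprime, h.gcd_eq]; exact hco)
      rw [residueClass, Set.indicator_of_notMem (by exact hdb), if_neg hd]
      simpa using mul_nonneg hw0 ht0
  have hsΛ := summable_vonMangoldt_div_rpow hs
  have hsN : Summable fun d : ℕ ↦ if d.Coprime k then 0 else Λ d / (d : ℝ) ^ s :=
    hsΛ.of_nonneg_of_le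
      (fun d ↦ by split_ifs; exacts [le_rfl, div_nonneg (hΛ d) (by positivity)])
      (fun d ↦ by split_ifs; exacts [div_nonneg (hΛ d) (by positivity), le_rfl])
  have hsum := (summable_vonMangoldt_mul hs hg0 hg1).prod
  simp only [tsum_mul_left] at hsum
  have hmain := hasSum_le hlow (((hsΛ.hasSum.sub hsN.hasSum).mul_left _).add
    ((summable_residueClass_div_rpow (b : ZMod k) hs).hasSum.mul_left _)) hsum.hasSum
  rw [← (hasSum_mul_log_div_rpow hs hg0 hg1).tsum_eq] at hmain
  have hup := tsum_residue_log_le hs hk hb hbk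
  have hnc := tsum_not_coprime_le hs (k := k) (by lia)
  have hprod := (hasSum_mul_log_div_rpow hs (g := fun _ ↦ 1) (by simp) (by simp)).tsum_eq
  simp only [one_mul, tsum_mul_right] at hprod
  rw [← hZ] at hup hprod
  rw [hprod] at hup
  set F := ∑' n : ℕ, residueClass (b : ZMod k) n / (n : ℝ) ^ s
  have hF0 : 0 ≤ F := tsum_nonneg fun n ↦ div_nonneg (residueClass_nonneg _ n) (by positivity)
  have hks : 1 / (k : ℝ) ^ s ≤ 1 / 2 := by
    have h2 : (2 : ℝ) ≤ k := mod_cast hk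
    refine one_div_le_one_div_of_le (by norm_num) (h2.trans ?_)
    simpa using Real.rpow_le_rpow_of_exponent_le (by linarith : (1 : ℝ) ≤ k) hs.le
  have h1 : F / 2 ≤ (1 - 1 / (k : ℝ) ^ s) * F := by nlinarith
  have h3 : 1 / (k : ℝ) ^ s * Z *
      (∑' d : ℕ, if d.Coprime k then 0 else Λ d / (d : ℝ) ^ s) ≤
      1 / (k : ℝ) ^ s * Z * Real.log k := by gcongr
  simp only [hg] at hmain
  linarith

lemma tendsto_residueClass {q : ℕ} [NeZero q] {a : ZMod q} (ha : IsUnit a) :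
    Tendsto (fun s : ℝ ↦ (s - 1) * ∑' n : ℕ, residueClass a n / (n : ℝ) ^ s) (𝓝[>] 1)
      (𝓝 (q.totient : ℝ)⁻¹) := by
  have H {x : ℝ} (hx : 1 < x) : ∑' n : ℕ, residueClass a n / (n : ℝ) ^ x =
      (vonMangoldt.LFunctionResidueClassAux a x).re + (q.totient : ℝ)⁻¹ / (x - 1) := by
    refine Complex.ofReal_injective ?_
    simp only [Complex.ofReal_tsum, Complex.ofReal_div, Complex.ofReal_cpow (Nat.cast_nonneg _),
      Complex.ofReal_natCast, Complex.ofReal_add, Complex.ofReal_inv, Complex.ofReal_sub,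
      Complex.ofReal_one]
    simp_rw [← vonMangoldt.LFunctionResidueClassAux_real ha hx,
      vonMangoldt.eqOn_LFunctionResidueClassAux ha <|
        Set.mem_ofPred.mpr (Complex.ofReal_re x ▸ hx), sub_add_cancel, LSeries, LSeries.term]
    refine tsum_congr fun n ↦ ?_
    split_ifs with hn
    · simp only [hn, vonMangoldt.residueClass_apply_zero, Complex.ofReal_zero, zero_div]
    · rfl
  have hcont : ContinuousOn (fun x : ℝ ↦ (vonMangoldt.LFunctionResidueClassAux a x).re)
      (Set.Ici 1) :=
    Complex.continuous_re.continuousOn.comp (t := Set.univ)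
      (vonMangoldt.continuousOn_LFunctionResidueClassAux a) (fun _ _ ↦ trivial) |>.comp
        Complex.continuous_ofReal.continuousOn fun x hx ↦ by
          simpa only [Set.mem_ofPred_eq, Complex.ofReal_re] using Set.mem_Ici.mp hx
  have h1 := ((hcont 1 Set.self_mem_Ici).mono Set.Ioi_subset_Ici_self).tendsto
  have h2 : Tendsto (fun s : ℝ ↦ s - 1) (𝓝[>] 1) (𝓝 0) := by
    have : Continuous fun s : ℝ ↦ s - 1 := by fun_prop
    simpa using (this.tendsto 1).mono_left nhdsWithin_le_nhds
  have h3 := (h2.mul h1).add_const ((q.totient : ℝ)⁻¹)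
  rw [zero_mul, zero_add] at h3
  refine h3.congr' ?_
  filter_upwards [self_mem_nhdsWithin] with s hs
  have hs : 1 < s := hs
  have : s - 1 ≠ 0 := by linarith
  rw [H hs]
  field_simp

/-- The primes `ρ ≡ a [MOD M]` other than `q` for which `α * ρ + β` is divisible by the square of
the odd prime `q`, where `q` does not divide `M * α`. -/
def squareDivisorPrimes (M : ℕ) (a : ZMod M) (α β : ℤ) (q : ℕ) : Set ℕ :=
  {ρ | ρ.Prime ∧ (ρ : ZMod M) = a ∧ q.Prime ∧ Odd q ∧ ¬ q ∣ M ∧ ¬ (q : ℤ) ∣ α ∧ q ≠ ρ ∧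
    (q : ℤ) ^ 2 ∣ α * ρ + β}

/-- The primes in `squareDivisorPrimes` lie in one residue class, whose least positive element is
not much smaller than `q ^ 2`. -/
lemma exists_residue_squareDivisorPrimes {M : ℕ} (hM : M ≠ 0) {a : ZMod M} (ha : IsUnit a)
    {α β : ℤ} (hne : ∀ n : ℕ, 0 < n → α * n + β ≠ 0) {q : ℕ}
    (h : (squareDivisorPrimes M a α β q).Nonempty) :
    ∃ b : ℕ, 1 ≤ b ∧ b < M * q ^ 2 ∧ b.Coprime (M * q ^ 2) ∧
      q ^ 2 ≤ (α.natAbs + β.natAbs) * b ∧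
      ∀ ρ ∈ squareDivisorPrimes M a α β q, (ρ : ZMod (M * q ^ 2)) = b := by
  obtain ⟨r, hr, hra, hq, hqodd, hqM, hqα, hqr, hdvd⟩ := h
  have hq2 := hq.two_le
  have hk : 2 ≤ M * q ^ 2 := by
    have : 1 ≤ M := by lia
    nlinarith
  have hrM : r.Coprime M := (ZMod.isUnit_iff_coprime r M).mp (hra ▸ ha)
  have hrq : r.Coprime (q ^ 2) := Nat.Coprime.pow_right 2 ((Nat.coprime_primes hr hq).mpr hqr.symm)
  have hco : (r % (M * q ^ 2)).Coprime (M * q ^ 2) := by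
    have := Nat.Coprime.mul_right hrM hrq
    rwa [Nat.Coprime, ← Nat.gcd_rec, Nat.gcd_comm]
  have hb : 1 ≤ r % (M * q ^ 2) := by
    rw [Nat.one_le_iff_ne_zero]
    intro h0
    rw [h0, Nat.coprime_zero_left] at hco
    lia
  refine ⟨r % (M * q ^ 2), hb, Nat.mod_lt _ (by lia), hco, ?_, ?_⟩
  · have hcong : (q : ℤ) ^ 2 ∣ α * (r % (M * q ^ 2) : ℕ) + β := by
      have h1 : (r : ℤ) = (r % (M * q ^ 2) : ℕ) + M * q ^ 2 * (r / (M * q ^ 2) : ℕ) := by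
        exact_mod_cast (Nat.mod_add_div r (M * q ^ 2)).symm
      rw [h1] at hdvd
      have h2 : (q : ℤ) ^ 2 ∣ α * (M * q ^ 2 * (r / (M * q ^ 2) : ℕ)) :=
        ⟨α * (M * (r / (M * q ^ 2) : ℕ)), by ring⟩
      convert! dvd_sub hdvd h2 using 1
      ring
    have h3 := Int.natAbs_dvd_natAbs.mpr hcong
    have h4 := Nat.le_of_dvd (Int.natAbs_pos.mpr (hne _ hb)) h3
    rw [Int.natAbs_pow, Int.natAbs_natCast] at h4
    refine h4.trans ((Int.natAbs_add_le _ _).trans ?_)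
    rw [Int.natAbs_mul, Int.natAbs_natCast, add_mul]
    gcongr
    exact Nat.le_mul_of_pos_right _ hb
  · rintro ρ ⟨-, hρa, -, -, -, -, -, hρ⟩
    rw [ZMod.natCast_mod, ZMod.natCast_eq_natCast_iff]
    refine (Nat.modEq_and_modEq_iff_modEq_mul ?_).mp ⟨?_, ?_⟩
    · exact Nat.Coprime.pow_right 2 ((Nat.Prime.coprime_iff_not_dvd hq).mpr hqM).symm
    · rw [← ZMod.natCast_eq_natCast_iff, hρa, hra]
    · rw [← Int.natCast_modEq_iff, Int.modEq_iff_dvd]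
      have h5 : (q : ℤ) ^ 2 ∣ α * (r - ρ) := by
        convert! dvd_sub hdvd hρ using 1
        ring
      push_cast
      refine IsCoprime.dvd_of_dvd_mul_left ?_ h5
      exact IsCoprime.pow_left ((Nat.prime_iff_prime_int.mp hq).coprime_iff_not_dvd.mpr hqα)

lemma tsum_odd_one_div_le :
    Summable (fun q : ℕ ↦ if Odd q ∧ 3 ≤ q then 1 / ((q : ℝ) * (q - 1)) else 0) ∧
    ∑' q : ℕ, (if Odd q ∧ 3 ≤ q then 1 / ((q : ℝ) * (q - 1)) else 0) ≤ 5 / 12 := by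
  set h : ℕ → ℝ := fun q ↦ if Odd q ∧ 3 ≤ q then 1 / ((q : ℝ) * (q - 1)) else 0 with hh
  have h0 (q : ℕ) : 0 ≤ h q := by
    simp only [hh]
    split_ifs with hq
    · have : (3 : ℝ) ≤ q := mod_cast hq.2
      have : (0 : ℝ) < q - 1 := by linarith
      positivity
    · exact le_rfl
  have hb (N : ℕ) : ∑ q ∈ Finset.range (N + 5), h q ≤ 5 / 12 - 1 / (N + 4 : ℝ) := by
    induction N with
    | zero =>
      simp only [hh, Finset.sum_range_succ, Finset.sum_range_zero]
      norm_num [Nat.odd_iff]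
    | succ N ih =>
      rw [show N + 1 + 5 = (N + 5) + 1 by ring, Finset.sum_range_succ]
      have : h (N + 5) ≤ 1 / (N + 4 : ℝ) - 1 / (N + 5 : ℝ) := by
        have he : 1 / (N + 4 : ℝ) - 1 / (N + 5 : ℝ) =
            1 / (((N + 5 : ℕ) : ℝ) * ((N + 5 : ℕ) - 1)) := by
          have h1 : ((N + 5 : ℕ) : ℝ) - 1 = N + 4 := by push_cast; ring
          rw [h1]
          push_cast
          field_simp
          ring
        rw [he]
        simp only [hh]
        split_ifs
        · exact le_rfl
        · have h1 : (0 : ℝ) ≤ ((N + 5 : ℕ) : ℝ) - 1 := by push_cast; linarith [N.cast_nonneg (α := ℝ)]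
          positivity
      push_cast
      rw [show (N : ℝ) + 1 + 4 = N + 5 by ring]
      linarith
  have hb' (N : ℕ) : ∑ q ∈ Finset.range N, h q ≤ 5 / 12 := by
    have h1 := Finset.sum_le_sum_of_subset_of_nonneg (f := h)
      (Finset.range_mono (by lia : N ≤ N + 5)) fun q _ _ ↦ h0 q
    have h2 : 0 ≤ 1 / (N + 4 : ℝ) := by positivity
    linarith [hb N]
  exact ⟨summable_of_sum_range_le h0 hb', Real.tsum_le_of_sum_range_le h0 hb'⟩

lemma summable_log_mul_sq_div (C : ℝ) (M : ℕ) :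
    Summable fun q : ℕ ↦ C * (Real.log M * (1 / (q : ℝ) ^ 2) + 4 * (1 / (q : ℝ) ^ (3 / 2 : ℝ))) :=
  (((Real.summable_one_div_nat_pow.mpr (by norm_num)).mul_left _).add
    ((Real.summable_one_div_nat_rpow.mpr (by norm_num)).mul_left _)).mul_left _

/-- A bound, summable over `q`, for primes in a residue class modulo `M * q ^ 2` whose least
element is at least `q ^ 2 / C`. -/
lemma sub_one_mul_tsum_residueClass_le {s : ℝ} (hs : 1 < s) (hs2 : s ≤ 2)
    (hZ : (s - 1) * ∑' n : ℕ, 1 / (n : ℝ) ^ s ≤ 2) {M q b C : ℕ} (hM : M ≠ 0) (hq : 2 ≤ q)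
    (hb : 1 ≤ b) (hbk : b < M * q ^ 2) (hco : b.Coprime (M * q ^ 2)) (hC : q ^ 2 ≤ C * b) :
    (s - 1) * ∑' n : ℕ, residueClass (b : ZMod (M * q ^ 2)) n / (n : ℝ) ^ s ≤
      (2 * C + 12) *
        (Real.log M * (1 / (q : ℝ) ^ 2) + 4 * (1 / (q : ℝ) ^ (3 / 2 : ℝ))) := by
  have hM1 : 1 ≤ M := by lia
  have hk : 2 ≤ M * q ^ 2 := by nlinarith
  set k := M * q ^ 2 with hkdef
  have hmain := mul_le_mul_of_nonneg_left (tsum_residueClass_le hs hk hb hbk hco)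
    (sub_nonneg.mpr hs.le)
  have hb1 : (1 : ℝ) ≤ b := mod_cast hb
  have hk2 : (2 : ℝ) ≤ k := mod_cast hk
  have hq0 : (0 : ℝ) < q := by positivity
  have hq2 : (0 : ℝ) < (q : ℝ) ^ 2 := by positivity
  have hlogk : 0 ≤ Real.log k := Real.log_natCast_nonneg _
  have hlog2 : Real.log (2 * k) ≤ 2 * Real.log k := by
    rw [Real.log_mul (by norm_num) (by positivity)]
    linarith [Real.log_le_log (by norm_num) hk2]
  have hfirst : (s - 1) * (Real.log b / (b : ℝ) ^ s) ≤ C * Real.log k / (q : ℝ) ^ 2 := by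
    have h1 : Real.log b / (b : ℝ) ^ s ≤ Real.log k / b := by
      refine div_le_div₀ hlogk (Real.log_le_log (by positivity) (mod_cast hbk.le)) (by positivity) ?_
      simpa using Real.rpow_le_rpow_of_exponent_le hb1 hs.le
    have h2 : Real.log k / b ≤ C * Real.log k / (q : ℝ) ^ 2 := by
      rw [div_le_div_iff₀ (by positivity) hq2]
      have : (q : ℝ) ^ 2 ≤ C * b := mod_cast hC
      nlinarith
    have h3 : 0 ≤ Real.log b / (b : ℝ) ^ s := by positivity
    nlinarith
  have hks : 1 / (k : ℝ) ^ s ≤ 1 / (q : ℝ) ^ 2 := by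
    refine one_div_le_one_div_of_le hq2 ?_
    have h1 : (k : ℝ) ≤ (k : ℝ) ^ s := by
      simpa using Real.rpow_le_rpow_of_exponent_le (by linarith : (1 : ℝ) ≤ k) hs.le
    refine le_trans ?_ h1
    have : q ^ 2 ≤ k := by rw [hkdef]; exact Nat.le_mul_of_pos_left _ hM1
    exact_mod_cast this
  have hsecond : (s - 1) * (1 / (k : ℝ) ^ s *
      ((Real.log (2 * k) + Real.log k) * ∑' n : ℕ, 1 / (n : ℝ) ^ s)) ≤
      6 * Real.log k / (q : ℝ) ^ 2 := by
    have hlog0 : 0 ≤ Real.log (2 * k) + Real.log k :=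
      add_nonneg (Real.log_nonneg (by linarith)) hlogk
    calc _ = 1 / (k : ℝ) ^ s * ((Real.log (2 * k) + Real.log k) *
          ((s - 1) * ∑' n : ℕ, 1 / (n : ℝ) ^ s)) := by ring
      _ ≤ 1 / (q : ℝ) ^ 2 * ((2 * Real.log k + Real.log k) * 2) := by
          gcongr
      _ = _ := by ring
  have hlogq : Real.log k / (q : ℝ) ^ 2 ≤
      Real.log M * (1 / (q : ℝ) ^ 2) + 4 * (1 / (q : ℝ) ^ (3 / 2 : ℝ)) := by
    have h1 : Real.log k = Real.log M + 2 * Real.log q := by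
      rw [hkdef, Nat.cast_mul, Nat.cast_pow, Real.log_mul (by positivity) (by positivity),
        Real.log_pow]
      norm_num
    have h2 := Real.log_natCast_le_rpow_div q (ε := 1 / 2) (by norm_num)
    have h3 : 1 / (q : ℝ) ^ (3 / 2 : ℝ) = (q : ℝ) ^ (1 / 2 : ℝ) / (q : ℝ) ^ 2 := by
      rw [one_div, ← Real.rpow_neg hq0.le, ← Real.rpow_natCast, ← Real.rpow_sub hq0]
      norm_num
    rw [h3, h1, mul_one_div, ← mul_div_assoc, ← add_div]
    refine div_le_div_of_nonneg_right ?_ hq2.le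
    linarith
  calc _ ≤ _ := hmain
    _ ≤ (2 * C + 12) * (Real.log k / (q : ℝ) ^ 2) := by
      have e1 : (2 * C + 12) * (Real.log k / (q : ℝ) ^ 2) =
        2 * (C * Real.log k / (q : ℝ) ^ 2 + 6 * Real.log k / (q : ℝ) ^ 2) := by ring
      rw [e1]
      linarith
    _ ≤ _ := by gcongr

/-- The primes in a residue class modulo `M` at which a linear form is divisible by the square of
an odd prime make up less than half of the class. -/
lemma eventually_tsum_squareDivisorPrimes_le {M : ℕ} (hM : M ≠ 0) {a : ZMod M} (ha : IsUnit a)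
    {α β : ℤ} (hne : ∀ n : ℕ, 0 < n → α * n + β ≠ 0) :
    ∀ᶠ s : ℝ in 𝓝[>] 1, (s - 1) * ∑' n : ℕ, (⋃ q, squareDivisorPrimes M a α β q).indicator
      (fun n : ℕ ↦ Λ n / (n : ℝ) ^ s) n ≤ 9 / 20 * (M.totient : ℝ)⁻¹ := by
  classical
  set S := squareDivisorPrimes M a α β with hS
  have hΛ (n : ℕ) : 0 ≤ Λ n := vonMangoldt_nonneg
  have hqS {q : ℕ} (h : (S q).Nonempty) : q.Prime ∧ Odd q ∧ ¬ q ∣ M := by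
    obtain ⟨r, -, -, h1, h2, h3, -⟩ := h
    exact ⟨h1, h2, h3⟩
  have hex (q : ℕ) : ∃ b : ℕ, (S q).Nonempty → 1 ≤ b ∧ b < M * q ^ 2 ∧
      b.Coprime (M * q ^ 2) ∧ q ^ 2 ≤ (α.natAbs + β.natAbs) * b ∧
      ∀ ρ ∈ S q, (ρ : ZMod (M * q ^ 2)) = b := by
    by_cases h : (S q).Nonempty
    · obtain ⟨b, hb⟩ := exists_residue_squareDivisorPrimes hM ha hne h
      exact ⟨b, fun _ ↦ hb⟩
    · exact ⟨0, fun h' ↦ absurd h' h⟩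
  choose b hb using hex
  set f : ℝ → ℕ → ℝ := fun s q ↦ if (S q).Nonempty then
    (s - 1) * ∑' n : ℕ, residueClass (b q : ZMod (M * q ^ 2)) n / (n : ℝ) ^ s else 0 with hf
  set g : ℕ → ℝ := fun q ↦ if (S q).Nonempty then (((M * q ^ 2).totient : ℕ) : ℝ)⁻¹ else 0 with hg
  set bound : ℕ → ℝ := fun q ↦ (2 * ((α.natAbs + β.natAbs : ℕ) : ℝ) + 12) *
    (Real.log M * (1 / (q : ℝ) ^ 2) + 4 * (1 / (q : ℝ) ^ (3 / 2 : ℝ))) with hbound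
  have hbsum : Summable bound := summable_log_mul_sq_div _ M
  have hlim (q : ℕ) : Tendsto (f · q) (𝓝[>] 1) (𝓝 (g q)) := by
    simp only [hf, hg]
    split_ifs with h
    · have : NeZero (M * q ^ 2) := ⟨mul_ne_zero hM (pow_ne_zero _ (hqS h).1.ne_zero)⟩
      exact tendsto_residueClass ((ZMod.isUnit_iff_coprime _ _).mpr (hb q h).2.2.1)
    · exact tendsto_const_nhds
  have hev : ∀ᶠ s : ℝ in 𝓝[>] 1, 1 < s ∧ ∀ q, ‖f s q‖ ≤ bound q := by
    have hZ := tendsto_sub_mul_tsum_nat_rpow.eventually_le_const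
      (by norm_num : (1 : ℝ) < 2)
    have h2 : ∀ᶠ s : ℝ in 𝓝[>] 1, s < 2 :=
      nhdsWithin_le_nhds (eventually_lt_nhds (by norm_num))
    filter_upwards [hZ, h2, self_mem_nhdsWithin] with s hZ hs2 hs
    have hs : 1 < s := hs
    refine ⟨hs, fun q ↦ ?_⟩
    simp only [hf]
    split_ifs with h
    · obtain ⟨h1, h3, h4, h5, -⟩ := hb q h
      rw [Real.norm_of_nonneg (mul_nonneg (by linarith)
        (tsum_nonneg fun n ↦ div_nonneg (residueClass_nonneg _ n) (by positivity)))]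
      exact sub_one_mul_tsum_residueClass_le hs hs2.le hZ hM (hqS h).1.two_le h1 h3 h4 h5
    · rw [norm_zero]
      have := Real.log_natCast_nonneg M
      positivity
  have hgle : ∑' q, g q ≤ 5 / 12 * (M.totient : ℝ)⁻¹ := by
    obtain ⟨hsum, hle⟩ := tsum_odd_one_div_le
    refine le_trans ?_ (mul_le_mul_of_nonneg_right hle (by positivity))
    rw [← tsum_mul_right]
    have hgh (q : ℕ) : g q ≤ (if Odd q ∧ 3 ≤ q then 1 / ((q : ℝ) * (q - 1)) else 0) *
        (M.totient : ℝ)⁻¹ := by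
      simp only [hg]
      split_ifs with h h' h'
      · obtain ⟨hq, -, hqM⟩ := hqS h
        have hcop : M.Coprime (q ^ 2) :=
          (Nat.Coprime.pow_left 2 (hq.coprime_iff_not_dvd.mpr hqM)).symm
        rw [Nat.totient_mul hcop, Nat.totient_prime_pow hq (by norm_num)]
        push_cast [hq.one_le]
        refine le_of_eq ?_
        field_simp
      · obtain ⟨hq, hodd, -⟩ := hqS h
        refine absurd ⟨hodd, ?_⟩ h'
        have := hq.two_le
        obtain ⟨t, rfl⟩ := hodd
        lia
      · have : (3 : ℝ) ≤ q := mod_cast h'.2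
        have : (0 : ℝ) < q - 1 := by linarith
        positivity
      · simp
    have hg0 (q : ℕ) : 0 ≤ g q := by simp only [hg]; split_ifs <;> positivity
    exact ((hsum.mul_right _).of_nonneg_of_le hg0 hgh).tsum_le_tsum hgh (hsum.mul_right _)
  have htot : (0 : ℝ) < (M.totient : ℝ)⁻¹ := by
    have := Nat.totient_pos.mpr (Nat.pos_of_ne_zero hM)
    positivity
  have htend := tendsto_tsum_of_dominated_convergence hbsum hlim (hev.mono fun s hs ↦ hs.2)
  filter_upwards [hev, htend.eventually_le_const
    (by linarith : ∑' q, g q < 9 / 20 * (M.totient : ℝ)⁻¹)] with s hs hfs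
  obtain ⟨hs, hsb⟩ := hs
  refine le_trans ?_ hfs
  have hfsum : Summable (f s) := hbsum.of_norm_bounded hsb
  have hf0 (q : ℕ) : 0 ≤ f s q := by
    simp only [hf]
    split_ifs
    · exact mul_nonneg (by linarith)
        (tsum_nonneg fun n ↦ div_nonneg (residueClass_nonneg _ n) (by positivity))
    · exact le_rfl
  have hw0 (n : ℕ) : 0 ≤ Λ n / (n : ℝ) ^ s := div_nonneg (hΛ n) (by positivity)
  have hind0 (T : Set ℕ) (n : ℕ) : 0 ≤ T.indicator (fun n : ℕ ↦ Λ n / (n : ℝ) ^ s) n :=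
    Set.indicator_apply_nonneg fun _ ↦ hw0 n
  rw [← tsum_mul_left]
  refine ((((summable_vonMangoldt_div_rpow hs).indicator _).mul_left _)).tsum_le_of_sum_le
    fun A ↦ ?_
  have hq (n : ℕ) : ∃ q, n ∈ (⋃ q, S q) → n ∈ S q := by
    by_cases h : n ∈ ⋃ q, S q
    · obtain ⟨q, hq⟩ := Set.mem_iUnion.mp h
      exact ⟨q, fun _ ↦ hq⟩
    · exact ⟨0, fun h' ↦ absurd h' h⟩
  choose Q hQ using hq
  calc _ ≤ ∑ n ∈ A, (s - 1) * ∑ q ∈ A.image Q,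
        (S q).indicator (fun n : ℕ ↦ Λ n / (n : ℝ) ^ s) n := by
        refine Finset.sum_le_sum fun n hn ↦ mul_le_mul_of_nonneg_left ?_ (by linarith)
        by_cases h : n ∈ ⋃ q, S q
        · rw [Set.indicator_of_mem h]
          refine le_trans (le_of_eq ?_) (Finset.single_le_sum (fun q _ ↦ hind0 (S q) n)
            (Finset.mem_image_of_mem Q hn))
          rw [Set.indicator_of_mem (hQ n h)]
        · rw [Set.indicator_of_notMem h]
          exact Finset.sum_nonneg fun q _ ↦ hind0 (S q) n
    _ = ∑ q ∈ A.image Q, (s - 1) * ∑ n ∈ A,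
        (S q).indicator (fun n : ℕ ↦ Λ n / (n : ℝ) ^ s) n := by
        simp only [← Finset.mul_sum]
        rw [Finset.sum_comm]
    _ ≤ ∑ q ∈ A.image Q, f s q := by
        refine Finset.sum_le_sum fun q _ ↦ ?_
        by_cases h : (S q).Nonempty
        · simp only [hf, if_pos h]
          refine mul_le_mul_of_nonneg_left ?_ (by linarith)
          refine le_trans (Finset.sum_le_sum fun n _ ↦ ?_)
            ((summable_residueClass_div_rpow _ hs).sum_le_tsum A
              fun n _ ↦ div_nonneg (residueClass_nonneg _ n) (by positivity))
          by_cases hn : n ∈ S q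
          · rw [Set.indicator_of_mem hn, residueClass,
              Set.indicator_of_mem (by exact (hb q h).2.2.2.2 n hn)]
          · rw [Set.indicator_of_notMem hn]
            exact div_nonneg (residueClass_nonneg _ n) (by positivity)
        · rw [Set.not_nonempty_iff_eq_empty.mp h]
          simpa using hf0 q
    _ ≤ _ := hfsum.sum_le_tsum _ fun q _ ↦ hf0 q

/-- In an invertible residue class there are infinitely many primes at which two linear forms are
not divisible by the square of an odd prime, away from the primes dividing the modulus or a leading
coefficient. -/
lemma infinite_setOf_notMem_squareDivisorPrimes {M : ℕ} (hM : M ≠ 0) {a : ZMod M}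
    (ha : IsUnit a) {α β γ δ : ℤ} (hne : ∀ n : ℕ, 0 < n → α * n + β ≠ 0)
    (hne' : ∀ n : ℕ, 0 < n → γ * n + δ ≠ 0) :
    {ρ : ℕ | ρ.Prime ∧ (ρ : ZMod M) = a ∧ (ρ ∉ ⋃ q, squareDivisorPrimes M a α β q) ∧
      ρ ∉ ⋃ q, squareDivisorPrimes M a γ δ q}.Infinite := by
  intro hfin
  have : NeZero M := ⟨hM⟩
  have hΛ (n : ℕ) : 0 ≤ Λ n := vonMangoldt_nonneg
  set G := {ρ : ℕ | ρ.Prime ∧ (ρ : ZMod M) = a ∧ (ρ ∉ ⋃ q, squareDivisorPrimes M a α β q) ∧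
      ρ ∉ ⋃ q, squareDivisorPrimes M a γ δ q} with hG
  have hGsum : Summable (G.indicator fun n : ℕ ↦ Λ n) :=
    summable_of_hasFiniteSupport (hfin.subset Set.support_indicator_subset)
  have hNsum := vonMangoldt.summable_residueClass_non_primes_div a
  set D := ∑' n : ℕ, (if n.Prime then 0 else residueClass a n) / (n : ℝ) +
    ∑' n : ℕ, G.indicator (fun n : ℕ ↦ Λ n) n with hD
  have htot : (0 : ℝ) < (M.totient : ℝ)⁻¹ := by
    have := Nat.totient_pos.mpr (Nat.pos_of_ne_zero hM)
    positivity
  have hlim : Tendsto (fun s : ℝ ↦ (s - 1) * D + 9 / 10 * (M.totient : ℝ)⁻¹) (𝓝[>] 1)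
      (𝓝 (9 / 10 * (M.totient : ℝ)⁻¹)) := by
    have : Continuous fun s : ℝ ↦ (s - 1) * D + 9 / 10 * (M.totient : ℝ)⁻¹ := by fun_prop
    simpa using (this.tendsto 1).mono_left nhdsWithin_le_nhds
  have hle := le_of_tendsto_of_tendsto (tendsto_residueClass ha) hlim (by
    filter_upwards [self_mem_nhdsWithin, eventually_tsum_squareDivisorPrimes_le hM ha hne,
      eventually_tsum_squareDivisorPrimes_le hM ha hne'] with s hs h1 h2
    have hs : 1 < s := hs
    set w : ℕ → ℝ := fun n ↦ Λ n / (n : ℝ) ^ s with hw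
    have hw0 (n : ℕ) : 0 ≤ w n := div_nonneg (hΛ n) (by positivity)
    have hpoint (n : ℕ) : residueClass a n / (n : ℝ) ^ s ≤
        (if n.Prime then 0 else residueClass a n) / (n : ℝ) + G.indicator (fun n : ℕ ↦ Λ n) n +
          ((⋃ q, squareDivisorPrimes M a α β q).indicator w n +
            (⋃ q, squareDivisorPrimes M a γ δ q).indicator w n) := by
      have hN0 : 0 ≤ (if n.Prime then 0 else residueClass a n) / (n : ℝ) :=
        div_nonneg (by split_ifs; exacts [le_rfl, residueClass_nonneg a n]) (by positivity)
      have hG0 : 0 ≤ G.indicator (fun n : ℕ ↦ Λ n) n := Set.indicator_apply_nonneg fun _ ↦ hΛ n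
      have h10 : 0 ≤ (⋃ q, squareDivisorPrimes M a α β q).indicator w n :=
        Set.indicator_apply_nonneg fun _ ↦ hw0 n
      have h20 : 0 ≤ (⋃ q, squareDivisorPrimes M a γ δ q).indicator w n :=
        Set.indicator_apply_nonneg fun _ ↦ hw0 n
      rcases Nat.eq_zero_or_pos n with rfl | hn
      · simpa using add_nonneg (add_nonneg hN0 hG0) (add_nonneg h10 h20)
      have hn1 : (1 : ℝ) ≤ n := mod_cast hn
      have hns : (n : ℝ) ≤ (n : ℝ) ^ s := by
        simpa using Real.rpow_le_rpow_of_exponent_le hn1 hs.le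
      by_cases hp : n.Prime
      · by_cases hna : (n : ZMod M) = a
        · have hr : residueClass a n / (n : ℝ) ^ s = w n := by
            rw [residueClass, Set.indicator_of_mem (by exact hna)]
          rw [hr]
          by_cases m1 : n ∈ ⋃ q, squareDivisorPrimes M a α β q
          · rw [Set.indicator_of_mem m1] at h10 ⊢
            linarith
          by_cases m2 : n ∈ ⋃ q, squareDivisorPrimes M a γ δ q
          · rw [Set.indicator_of_mem m2] at h20 ⊢
            linarith
          have hnG : n ∈ G := ⟨hp, hna, m1, m2⟩
          rw [Set.indicator_of_mem hnG]
          have : w n ≤ Λ n := div_le_self (hΛ n) (hn1.trans hns)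
          linarith
        · rw [residueClass, Set.indicator_of_notMem (by exact hna), zero_div]
          rw [residueClass, Set.indicator_of_notMem (by exact hna)] at hN0
          linarith
      · rw [if_neg hp]
        have := div_le_div_of_nonneg_left (residueClass_nonneg a n) (by linarith) hns
        linarith
    have hind (T : Set ℕ) : Summable (T.indicator w) :=
      (summable_vonMangoldt_div_rpow hs).indicator T
    have hsum := hasSum_le hpoint (summable_residueClass_div_rpow a hs).hasSum
      ((hNsum.hasSum.add hGsum.hasSum).add ((hind _).hasSum.add (hind _).hasSum))
    have hmul := mul_le_mul_of_nonneg_left hsum (sub_nonneg.mpr hs.le)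
    rw [mul_add (s - 1), mul_add (s - 1) (∑' n : ℕ, _) (∑' n : ℕ, _)] at hmul
    linarith)
  linarith

/-- A residue class modulo `p * R` in which neither `p` nor a prime factor of `R` obstructs
squarefreeness. -/
lemma exists_residue_avoiding {p : ℕ} (hp : p.Prime) (hp3 : 3 ≤ p) (u R : ℤ)
    (hR : R = p ^ 2 + 2 + 4 * p * u) :
    ∃ a : ℤ, IsCoprime a (p * R) ∧ ¬ (p : ℤ) ∣ a - 2 * u ∧ R ∣ 2 * p * a - 1 := by
  have hpodd : Odd (p : ℤ) := by exact_mod_cast hp.odd_of_ne_two (by lia)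
  have hpp : Prime (p : ℤ) := Nat.prime_iff_prime_int.mp hp
  have hp2 : ¬ (p : ℤ) ∣ 2 := fun h ↦ by
    have := Int.le_of_dvd (by norm_num) h
    lia
  have hRp : IsCoprime (p : ℤ) R := by
    refine hpp.coprime_iff_not_dvd.mpr fun h ↦ hp2 ?_
    have h1 : (2 : ℤ) = R - p * (p + 4 * u) := by rw [hR]; ring
    rw [h1]
    exact dvd_sub h (Dvd.intro _ rfl)
  have hR2 : IsCoprime (2 : ℤ) R := by
    refine Int.prime_two.coprime_iff_not_dvd.mpr fun h ↦ ?_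
    have h1 : Odd R := by
      rw [hR]
      have h2 : Even (2 + 4 * p * u : ℤ) := ⟨1 + 2 * p * u, by ring⟩
      rw [add_assoc]
      exact hpodd.pow.add_even h2
    exact (Int.not_even_iff_odd.mpr h1) (even_iff_two_dvd.mpr h)
  obtain ⟨w, v, hw⟩ := hR2.mul_left hRp
  obtain ⟨x, y, hxy⟩ := hRp
  obtain ⟨e, he, heu⟩ : ∃ e : ℤ, ¬ (p : ℤ) ∣ e ∧ ¬ (p : ℤ) ∣ e - 2 * u := by
    by_cases h : (p : ℤ) ∣ u
    · refine ⟨1, hpp.not_dvd_one, fun h' ↦ hpp.not_dvd_one ?_⟩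
      have := dvd_add h' (h.mul_left 2)
      simpa using this
    · refine ⟨-2 * u, fun h' ↦ ?_, fun h' ↦ ?_⟩
      · rcases hpp.dvd_or_dvd h' with h1 | h1
        · exact hp2 (by simpa using h1)
        · exact h h1
      · have h1 : (p : ℤ) ∣ 2 * (2 * u) := by
          have := (dvd_neg.mpr h')
          convert! this using 1
          ring
        rcases hpp.dvd_or_dvd h1 with h2 | h2
        · exact hp2 h2
        · exact (hpp.dvd_or_dvd h2).elim hp2 h
  have hap : (p : ℤ) ∣ (w * x * p + e * y * R) - e :=
    ⟨w * x - e * x, by linear_combination e * hxy⟩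
  have haR : R ∣ 2 * p * (w * x * p + e * y * R) - 1 :=
    ⟨2 * p * (e * y - w * y) - v, by linear_combination 2 * p * w * hxy + hw⟩
  refine ⟨w * x * p + e * y * R, IsCoprime.mul_right ?_ ?_, fun h ↦ heu ?_, haR⟩
  · refine (hpp.coprime_iff_not_dvd.mpr fun h ↦ he ?_).symm
    simpa using dvd_sub h hap
  · obtain ⟨t, ht⟩ := haR
    exact ⟨2 * p, -t, by linear_combination ht⟩
  · have := dvd_sub h hap
    convert! this using 1
    ring

theorem stmt_19 (p : ℕ) (hp : p.Prime) (hp3 : 3 ≤ p) (u : ℤ) :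
    {ρ : ℕ | ρ.Prime ∧ Squarefree ((p : ℤ) * (2 * p * ρ + 1) *
      (8 * ρ - 16 * p * u ^ 2 - 8 * (p : ℤ) ^ 2 * u - 16 * u - 4 * p
        - (p : ℤ) ^ 3))}.Infinite := by
  obtain ⟨R, hR⟩ : ∃ R : ℤ, R = p ^ 2 + 2 + 4 * p * u := ⟨_, rfl⟩
  obtain ⟨c, hc⟩ : ∃ c : ℤ, c = 16 * p * u ^ 2 + 8 * (p : ℤ) ^ 2 * u + 16 * u + 4 * p +
    (p : ℤ) ^ 3 := ⟨_, rfl⟩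
  have hpodd : Odd (p : ℤ) := by exact_mod_cast hp.odd_of_ne_two (by lia)
  have hpp : Prime (p : ℤ) := Nat.prime_iff_prime_int.mp hp
  have hp2 : ¬ (p : ℤ) ∣ 2 := fun h ↦ by
    have := Int.le_of_dvd (by norm_num) h
    lia
  have hcodd : Odd c := by
    have h1 : Even (16 * p * u ^ 2 + 8 * (p : ℤ) ^ 2 * u + 16 * u + 4 * p) :=
      ⟨8 * p * u ^ 2 + 4 * (p : ℤ) ^ 2 * u + 8 * u + 2 * p, by ring⟩
    rw [hc]
    exact h1.add_odd hpodd.pow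
  have hc0 : c ≠ 0 := by
    rintro rfl
    exact absurd hcodd (by decide)
  have hodd (n : ℤ) : Odd (8 * n + -c) := by
    have h1 : Even (8 * n) := ⟨4 * n, by ring⟩
    exact h1.add_odd hcodd.neg
  obtain ⟨a, haM, hap, haR⟩ := exists_residue_avoiding hp hp3 u R hR
  have hR0 : R ≠ 0 := by
    rintro rfl
    obtain ⟨t, ht⟩ := haR
    have h1 : (p : ℤ) * (p + 4 * u) = -2 := by linear_combination -hR
    exact hp2 (by simpa using (Dvd.intro _ h1 : (p : ℤ) ∣ -2))
  have hM : p * R.natAbs ≠ 0 := mul_ne_zero hp.ne_zero (Int.natAbs_ne_zero.mpr hR0)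
  have hMabs : ((p * R.natAbs : ℕ) : ℤ) = p * |R| := by
    rw [Nat.cast_mul, Int.natCast_natAbs]
  have haunit : IsUnit (a : ZMod (p * R.natAbs)) := by
    rw [ZMod.coe_int_isUnit_iff_isCoprime, hMabs]
    have h1 : IsCoprime (p * |R|) a := by
      rcases abs_choice R with h | h <;> rw [h]
      · exact haM.symm
      · rw [mul_neg]
        exact haM.symm.neg_left
    exact h1
  have hinf := infinite_setOf_notMem_squareDivisorPrimes hM haunit (α := 2 * p) (β := 1)
    (γ := 8) (δ := -c) (fun n _ h ↦ by
      have : (0 : ℤ) ≤ 2 * p * n := by positivity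
      lia) (fun n _ h ↦ by
      have := hodd n
      rw [h] at this
      exact absurd this (by decide))
  refine (hinf.sdiff (Set.finite_Iic c.natAbs)).mono ?_
  rintro ρ ⟨⟨hρ, hρa, hS₁, hS₂⟩, hρc⟩
  have hρc : c.natAbs < ρ := by simpa using hρc
  refine ⟨hρ, ?_⟩
  rw [show (8 * ρ - 16 * p * u ^ 2 - 8 * (p : ℤ) ^ 2 * u - 16 * u - 4 * p - (p : ℤ) ^ 3) =
    8 * ρ + -c by rw [hc]; ring]
  have hMdvd : (p : ℤ) * |R| ∣ ρ - a := by
    rw [← hMabs, ← ZMod.intCast_zmod_eq_zero_iff_dvd]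
    push_cast
    rw [hρa, sub_self]
  have hpρ : (p : ℤ) ∣ ρ - a := (Dvd.intro _ rfl).trans hMdvd
  have hRρ : R ∣ ρ - a := ((dvd_abs R R).mpr dvd_rfl).trans ((Dvd.intro_left _ rfl).trans hMdvd)
  have hres : 8 * (2 * p * ρ + 1) - 2 * p * (8 * ρ + -c) = 2 * R ^ 2 := by
    rw [hc, hR]
    ring
  rw [← Int.squarefree_natAbs, Nat.squarefree_iff_prime_squarefree]
  intro q hq hqq
  have hqp : Prime (q : ℤ) := Nat.prime_iff_prime_int.mp hq
  have hdvd : (q : ℤ) ^ 2 ∣ p * (2 * p * ρ + 1) * (8 * ρ + -c) := by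
    rw [pow_two, ← Nat.cast_mul]
    exact Int.natCast_dvd.mpr hqq
  have hq2 : q ≠ 2 := by
    rintro rfl
    have h1 : Odd ((p : ℤ) * (2 * p * ρ + 1) * (8 * ρ + -c)) :=
      (hpodd.mul ⟨p * ρ, by ring⟩).mul (hodd ρ)
    have h2 := (dvd_pow_self (2 : ℤ) two_ne_zero).trans hdvd
    exact (Int.not_even_iff_odd.mpr h1) (even_iff_two_dvd.mpr h2)
  have hq2' : ¬ (q : ℤ) ∣ 2 := fun h ↦
    hq2 ((Nat.prime_dvd_prime_iff_eq hq Nat.prime_two).mp (by exact_mod_cast h))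
  have hpow2 (k : ℕ) : ¬ (q : ℤ) ∣ 2 ^ k := fun h ↦ hq2' (hqp.dvd_of_dvd_pow h)
  have hL₁p : ¬ (p : ℤ) ∣ 2 * p * ρ + 1 := fun h ↦ hpp.not_dvd_one <| by
    have := dvd_sub h (Dvd.intro (2 * (ρ : ℤ)) rfl : (p : ℤ) ∣ p * (2 * ρ))
    convert! this using 1
    ring
  have hqp' : q ≠ p := by
    rintro rfl
    rw [pow_two, mul_assoc] at hdvd
    have h1 := Int.dvd_of_mul_dvd_mul_left hpp.ne_zero hdvd
    rcases hpp.dvd_or_dvd h1 with h | h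
    · exact hL₁p h
    · have h3 : (q : ℤ) ∣ 2 ^ 3 * (a - 2 * u) := by
        have h4 : (q : ℤ) ∣ q * (16 * u ^ 2 + 8 * q * u + 4 + q ^ 2) := Dvd.intro _ rfl
        convert! dvd_sub (dvd_add h h4) (hpρ.mul_left 8) using 1
        rw [hc]
        ring
      exact (hqp.dvd_or_dvd h3).elim (hpow2 3) hap
  have hqnp : ¬ (q : ℤ) ∣ p := fun h ↦
    hqp' ((Nat.prime_dvd_prime_iff_eq hq hp).mp (by exact_mod_cast h))
  rw [mul_assoc] at hdvd
  replace hdvd := hqp.pow_dvd_of_dvd_mul_left 2 hqnp hdvd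
  have hq2p : ¬ (q : ℤ) ∣ 2 * p := fun h ↦ (hqp.dvd_or_dvd h).elim hq2' hqnp
  have hqR : ¬ (q : ℤ) ∣ R := by
    intro h
    have h1 : (q : ℤ) ∣ 2 * p * ρ - 1 := by
      have := dvd_add ((h.trans hRρ).mul_left (2 * p)) (h.trans haR)
      convert! this using 1
      ring
    rcases hqp.dvd_or_dvd ((dvd_pow_self _ two_ne_zero).trans hdvd) with h2 | h2
    · refine hpow2 1 ?_
      convert! dvd_sub h2 h1 using 1
      ring
    · refine hpow2 4 ?_
      have h3 : (q : ℤ) ∣ 2 * R ^ 2 := (dvd_pow h two_ne_zero).mul_left 2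
      convert! dvd_sub (dvd_add h3 (h2.mul_left (2 * p))) (h1.mul_left 8) using 1
      linear_combination hres
  have hqM : ¬ q ∣ p * R.natAbs := fun h ↦ by
    rcases (hq.dvd_mul).mp h with h1 | h1
    · exact hqnp (by exact_mod_cast h1)
    · exact hqR (Int.natCast_dvd.mpr h1)
  by_cases h₁ : (q : ℤ) ∣ 2 * p * ρ + 1
  · have h₂ : ¬ (q : ℤ) ∣ 8 * ρ + -c := fun h₂ ↦ by
      have h3 := dvd_sub (h₁.mul_left 8) (h₂.mul_left (2 * p))
      rw [hres] at h3
      exact (hqp.dvd_or_dvd h3).elim hq2' fun h ↦ hqR (hqp.dvd_of_dvd_pow h)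
    refine hS₁ (Set.mem_iUnion.mpr ⟨q, hρ, hρa, hq, hq.odd_of_ne_two hq2, hqM, hq2p, ?_,
      hqp.pow_dvd_of_dvd_mul_right 2 h₂ hdvd⟩)
    rintro rfl
    refine hqp.not_dvd_one ?_
    have := dvd_sub h₁ (Dvd.intro_left (2 * p : ℤ) rfl : (q : ℤ) ∣ 2 * p * q)
    simpa using this
  · refine hS₂ (Set.mem_iUnion.mpr ⟨q, hρ, hρa, hq, hq.odd_of_ne_two hq2, hqM, hpow2 3, ?_,
      hqp.pow_dvd_of_dvd_mul_left 2 h₁ hdvd⟩)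
    rintro rfl
    have h2 : (q : ℤ) ∣ 8 * q + -c :=
      (dvd_pow_self _ two_ne_zero).trans (hqp.pow_dvd_of_dvd_mul_left 2 h₁ hdvd)
    have h3 : (q : ℤ) ∣ c := by
      have := dvd_sub (Dvd.intro_left (8 : ℤ) rfl : (q : ℤ) ∣ 8 * q) h2
      simpa using this
    have h4 := Nat.le_of_dvd (Int.natAbs_pos.mpr hc0) (Int.natCast_dvd.mp h3)
    lia
end
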